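/- arXiv:2303.11025 — 2 statements merged into one kernel-verified Lean document; each statement's English description precedes it below -/
import Mathlib

section
/- For any permutation ω ∈ S_n, the sets L(P), for P ranging over the acyclic reduced pipe dreams of Π(ω), are pairwise disjoint, all nonempty, and their union is exactly the weak order interval [e,ω]; that is, {L(P) : P ∈ Π(ω) acyclic} is a partition of [e,ω]. -/
/-- A pipe dream of size `n` on the triangular shape, with boxes indexed by pairs
`(r, c)` of a row `r` and a column `c`, both `0`-indexed (rows increase southwards,
columns increase eastwards).  `cross r c = true` means that box `(r, c)` contains a
crossing tile; all other boxes contain elbow tiles.  Crossings are only allowed in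
the full boxes of the triangular shape, i.e. those with `r + c + 2 ≤ n` (the boxes
with `r + c + 1 = n` are the half-boxes on the antidiagonal, which are forced
elbows).  The `n` pipes enter horizontally on the left side in rows `0, …, n-1` and
exit vertically on the top side in columns `0, …, n-1`; pipe `k` is the pipe
entering at row `k`.  An elbow tile connects the west edge of its box to the north
edge (the pipe travelling through this elbow passes northwest of the tile) and the
south edge to the east edge (this pipe passes southeast of the tile); a crossing
tile connects west to east and south to north. -/
structure PipeDream (n : ℕ) where
  cross : ℕ → ℕ → Bool
  inShape : ∀ r c : ℕ, cross r c = true → r + c + 2 ≤ n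

namespace PipeDream

variable {n : ℕ}

/-- `(P.pipes r c).1` is the label of the pipe entering box `(r, c)` from the west,
and `(P.pipes r c).2` is the label of the pipe entering box `(r, c)` from the south
(junk value `0` if there is no box below box `(r, c)` in the triangular shape). -/
def pipes (P : PipeDream n) : ℕ → ℕ → ℕ × ℕ
  | r, c =>
    (if hc : c = 0 then r
      else if P.cross r (c - 1) then (pipes P r (c - 1)).1 else (pipes P r (c - 1)).2,
     if hr : r + c + 2 ≤ n then
        if P.cross (r + 1) c then (pipes P (r + 1) c).2 else (pipes P (r + 1) c).1
      else 0)
  termination_by r c => (n - r) + c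
  decreasing_by all_goals omega

/-- The pipe entering box `(r, c)` from the west (travelling eastwards). -/
def west (P : PipeDream n) (r c : ℕ) : ℕ := (pipes P r c).1

/-- The pipe entering box `(r, c)` from the south (travelling northwards). -/
def south (P : PipeDream n) (r c : ℕ) : ℕ := (pipes P r c).2

/-- The pipe exiting on the top side at column `c`. -/
def exitPipe (P : PipeDream n) (c : ℕ) : ℕ :=
  if P.cross 0 c then P.south 0 c else P.west 0 c

/-- `P` has exit permutation `ω`, i.e. the pipe exiting at column `c` is `ω c`;
equivalently, pipe `k` exits at column `ω⁻¹ k`. -/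
def HasExitPerm (P : PipeDream n) (ω : Equiv.Perm (Fin n)) : Prop :=
  ∀ c : Fin n, P.exitPipe c.val = (ω c).val

/-- `P` is reduced: any two of its pipes cross at most once. -/
def Reduced (P : PipeDream n) : Prop :=
  ∀ r c r' c' : ℕ, P.cross r c = true → P.cross r' c' = true → (r, c) ≠ (r', c') →
    ¬ ((P.west r c = P.west r' c' ∧ P.south r c = P.south r' c') ∨
        (P.west r c = P.south r' c' ∧ P.south r c = P.west r' c'))

/-- The arcs of the contact graph `P♯` of `P`: there is one arc for each elbow
contact of `P` (an elbow tile in a full box of the triangular shape), oriented from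
the pipe passing northwest of the contact (the one travelling west-to-north) to the
pipe passing southeast of it (the one travelling south-to-east). -/
def Arc (P : PipeDream n) (i j : ℕ) : Prop :=
  ∃ r c : ℕ, r + c + 2 ≤ n ∧ P.cross r c = false ∧ P.west r c = i ∧ P.south r c = j

/-- `P` is acyclic: its contact graph has no directed cycle. -/
def Acyclic (P : PipeDream n) : Prop := ∀ i : ℕ, ¬ Relation.TransGen P.Arc i i

/-- `i ⪯_P j` : there is a directed path (possibly empty) from `i` to `j` in the
contact graph of `P`. -/
def Path (P : PipeDream n) (i j : ℕ) : Prop := Relation.ReflTransGen P.Arc i j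

/-- `π` is a linear extension of `P` : `π⁻¹ i < π⁻¹ j` for every arc `i → j` of the
contact graph of `P`. -/
def LinExt (P : PipeDream n) (π : Equiv.Perm (Fin n)) : Prop :=
  ∀ i j : Fin n, P.Arc i.val j.val → π⁻¹ i < π⁻¹ j

/-- There is a contact (an elbow tile in a full box) between pipes `i` and `j`
at box `b`. -/
def ContactAt (P : PipeDream n) (i j : ℕ) (b : ℕ × ℕ) : Prop :=
  b.1 + b.2 + 2 ≤ n ∧ P.cross b.1 b.2 = false ∧
    ((P.west b.1 b.2 = i ∧ P.south b.1 b.2 = j) ∨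
      (P.west b.1 b.2 = j ∧ P.south b.1 b.2 = i))

/-- `P'` is obtained from `P` by the flip exchanging the contact at box `b` with the
crossing at box `b'` (a contact and a crossing between the same two pipes). -/
def IsFlip (P P' : PipeDream n) (b b' : ℕ × ℕ) : Prop :=
  b ≠ b' ∧
  P.cross b.1 b.2 = false ∧ P.cross b'.1 b'.2 = true ∧
  P'.cross b.1 b.2 = true ∧ P'.cross b'.1 b'.2 = false ∧
  (∀ r c : ℕ, (r, c) ≠ b → (r, c) ≠ b' → P.cross r c = P'.cross r c) ∧
  ((P.west b.1 b.2 = P.west b'.1 b'.2 ∧ P.south b.1 b.2 = P.south b'.1 b'.2) ∨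
    (P.west b.1 b.2 = P.south b'.1 b'.2 ∧ P.south b.1 b.2 = P.west b'.1 b'.2))

/-- There is an increasing flip from `P` to `P'`: a flip exchanging a contact at a
box `b` weakly southwest of the box `b'` of the corresponding crossing. -/
def IncFlip (P P' : PipeDream n) : Prop :=
  ∃ b b' : ℕ × ℕ, P.IsFlip P' b b' ∧ b'.1 ≤ b.1 ∧ b.2 ≤ b'.2

end PipeDream

/-- The weak order on permutations of `Fin n` : `π ≤ σ` if and only if
`Inv(π) ⊆ Inv(σ)`, where `Inv(π)` is the set of pairs `(i, j)` with `i < j` and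
`π⁻¹ i > π⁻¹ j`. -/
def WeakLE {n : ℕ} (π σ : Equiv.Perm (Fin n)) : Prop :=
  ∀ i j : Fin n, i < j → π⁻¹ j < π⁻¹ i → σ⁻¹ j < σ⁻¹ i

namespace PipeDream

variable {n : ℕ}

/-- The pipe leaving box `(r, c)` northwards. -/
def north (P : PipeDream n) (r c : ℕ) : ℕ :=
  if P.cross r c then P.south r c else P.west r c

theorem west_zero (P : PipeDream n) (r : ℕ) : P.west r 0 = r := by
  unfold west; rw [pipes]; simp

theorem west_succ (P : PipeDream n) (r c : ℕ) :
    P.west r (c + 1) = if P.cross r c then P.west r c else P.south r c := by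
  unfold west south; rw [pipes]; simp

theorem south_eq (P : PipeDream n) {r c : ℕ} (h : r + c + 2 ≤ n) :
    P.south r c = P.north (r + 1) c := by
  unfold north west south; rw [pipes]; simp [h]

theorem exit_eq (P : PipeDream n) (c : ℕ) : P.exitPipe c = P.north 0 c := rfl

theorem west_succ_cross (P : PipeDream n) {r c : ℕ} (h : P.cross r c = true) :
    P.west r (c + 1) = P.west r c := by simp [west_succ, h]

theorem west_succ_elbow (P : PipeDream n) {r c : ℕ} (h : P.cross r c = false) :
    P.west r (c + 1) = P.south r c := by simp [west_succ, h]

theorem north_cross (P : PipeDream n) {r c : ℕ} (h : P.cross r c = true) :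
    P.north r c = P.south r c := by simp [north, h]

theorem north_elbow (P : PipeDream n) {r c : ℕ} (h : P.cross r c = false) :
    P.north r c = P.west r c := by simp [north, h]

theorem elbow_half (P : PipeDream n) {r c : ℕ} (h : ¬ r + c + 2 ≤ n) :
    P.cross r c = false := by
  by_contra hc
  exact h (P.inShape r c (by simpa using hc))

/-- Downward induction on the rows of a column. -/
theorem row_induction {c : ℕ} {Q : ℕ → Prop}
    (h0 : ∀ r, r + c + 1 = n → Q r)
    (h1 : ∀ r, r + c + 2 ≤ n → Q (r + 1) → Q r) : ∀ r, r + c + 1 ≤ n → Q r := by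
  have key : ∀ d r, r + c + 1 + d = n → Q r := by
    intro d
    induction d with
    | zero => intro r hr; exact h0 r (by omega)
    | succ d ih => intro r hr; exact h1 r (by omega) (ih (r + 1) (by omega))
  intro r hr
  exact key (n - (r + c + 1)) r (by omega)

theorem north_mem (P : PipeDream n) (c : ℕ) : ∀ r, r + c + 1 ≤ n →
    ∃ r', r ≤ r' ∧ r' + c + 1 ≤ n ∧ P.north r c = P.west r' c := by
  apply row_induction
  · intro r hr
    exact ⟨r, le_rfl, by omega, P.north_elbow (P.elbow_half (by omega))⟩
  · rintro r hr ⟨r', h1, h2, h3⟩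
    cases hc : P.cross r c
    · exact ⟨r, le_rfl, by omega, P.north_elbow hc⟩
    · exact ⟨r', by omega, h2, by rw [P.north_cross hc, P.south_eq hr, h3]⟩

theorem south_mem (P : PipeDream n) {r c : ℕ} (h : r + c + 2 ≤ n) :
    ∃ r', r < r' ∧ r' + c + 1 ≤ n ∧ P.south r c = P.west r' c := by
  obtain ⟨r', h1, h2, h3⟩ := P.north_mem c (r + 1) (by omega)
  exact ⟨r', by omega, h2, by rw [P.south_eq h, h3]⟩

theorem west_succ_mem (P : PipeDream n) {r c : ℕ} (h : r + c + 2 ≤ n) :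
    ∃ r', r ≤ r' ∧ r' + c + 1 ≤ n ∧ P.west r (c + 1) = P.west r' c := by
  cases hc : P.cross r c
  · obtain ⟨r', h1, h2, h3⟩ := P.south_mem h
    exact ⟨r', by omega, h2, by rw [P.west_succ_elbow hc, h3]⟩
  · exact ⟨r, le_rfl, by omega, P.west_succ_cross hc⟩

theorem west_lt (P : PipeDream n) (c : ℕ) : ∀ r, r + c + 1 ≤ n → P.west r c < n := by
  induction c with
  | zero => intro r hr; rw [west_zero]; omega
  | succ c ih =>
    intro r hr
    obtain ⟨r', h1, h2, h3⟩ := P.west_succ_mem (r := r) (c := c) (by omega)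
    rw [h3]; exact ih r' h2

theorem south_lt (P : PipeDream n) {r c : ℕ} (h : r + c + 2 ≤ n) : P.south r c < n := by
  obtain ⟨r', h1, h2, h3⟩ := P.south_mem h
  rw [h3]; exact P.west_lt c r' h2

theorem north_lt (P : PipeDream n) {r c : ℕ} (h : r + c + 1 ≤ n) : P.north r c < n := by
  obtain ⟨r', h1, h2, h3⟩ := P.north_mem c r h
  rw [h3]; exact P.west_lt c r' h2

/-- The labels entering column `c` are distinct. -/
def ColInj (P : PipeDream n) (c : ℕ) : Prop :=
  ∀ r r', r + c + 1 ≤ n → r' + c + 1 ≤ n → P.west r c = P.west r' c → r = r'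

theorem col_step (P : PipeDream n) {c : ℕ} (hI : P.ColInj c) : ∀ R, R + c + 1 ≤ n →
    (∀ r, R ≤ r → r + c + 2 ≤ n → P.west r (c + 1) ≠ P.north R c) ∧
    (∀ r r', R ≤ r → r < r' → r' + c + 2 ≤ n → P.west r (c + 1) ≠ P.west r' (c + 1)) := by
  apply row_induction
  · intro R hR
    exact ⟨fun r h1 h2 => by omega, fun r r' h1 h2 h3 => by omega⟩
  · rintro R hR ⟨ih1, ih2⟩
    have hne : ∀ r, R + 1 ≤ r → r + c + 2 ≤ n → P.west r (c + 1) ≠ P.west R c := by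
      intro r h1 h2 h3
      obtain ⟨r', h4, h5, h6⟩ := P.west_succ_mem h2
      have := hI r' R h5 (by omega) (by rw [← h6, h3])
      omega
    have hne2 : P.south R c ≠ P.west R c := by
      intro h3
      obtain ⟨r', h4, h5, h6⟩ := P.south_mem hR
      have := hI r' R h5 (by omega) (by rw [← h6, h3])
      omega
    rw [← P.south_eq hR] at ih1
    cases hc : P.cross R c
    · have e1 := P.west_succ_elbow hc
      have e2 := P.north_elbow hc
      constructor
      · intro r h1 h2
        rcases Nat.eq_or_lt_of_le h1 with h | h
        · subst h; rw [e1, e2]; exact hne2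
        · rw [e2]; exact hne r h h2
      · intro r r' h1 h2 h3
        rcases Nat.eq_or_lt_of_le h1 with h | h
        · subst h; rw [e1]; exact (ih1 r' (by omega) h3).symm
        · exact ih2 r r' h h2 h3
    · have e1 := P.west_succ_cross hc
      have e2 := P.north_cross hc
      constructor
      · intro r h1 h2
        rcases Nat.eq_or_lt_of_le h1 with h | h
        · subst h; rw [e1, e2]; exact hne2.symm
        · rw [e2]; exact ih1 r h h2
      · intro r r' h1 h2 h3
        rcases Nat.eq_or_lt_of_le h1 with h | h
        · subst h; rw [e1]; exact (hne r' (by omega) h3).symm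
        · exact ih2 r r' h h2 h3

theorem colInj (P : PipeDream n) (c : ℕ) : P.ColInj c := by
  induction c with
  | zero => intro r r' _ _ h; simpa [west_zero] using h
  | succ c ih =>
    intro r r' h1 h2 h3
    have := (P.col_step ih 0 (by omega)).2
    rcases Nat.lt_trichotomy r r' with h | h | h
    · exact absurd h3 (this r r' (by omega) h (by omega))
    · exact h
    · exact absurd h3.symm (this r' r (by omega) h (by omega))

theorem west_ne_south (P : PipeDream n) {r c : ℕ} (h : r + c + 2 ≤ n) :
    P.west r c ≠ P.south r c := by
  intro h3
  obtain ⟨r', h4, h5, h6⟩ := P.south_mem h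
  have := P.colInj c r' r h5 (by omega) (by rw [← h6, h3])
  omega

theorem exit_ne_succ (P : PipeDream n) {r c : ℕ} (h : r + c + 2 ≤ n) :
    P.west r (c + 1) ≠ P.exitPipe c :=
  (P.col_step (P.colInj c) 0 (by omega)).1 r (by omega) h

theorem exit_ne (P : PipeDream n) (c d : ℕ) : ∀ r, r + (c + d) + 2 ≤ n →
    P.west r (c + d + 1) ≠ P.exitPipe c := by
  induction d with
  | zero => intro r h; exact P.exit_ne_succ h
  | succ d ih =>
    intro r h
    obtain ⟨r', h4, h5, h6⟩ := P.west_succ_mem (r := r) (c := c + d + 1) (by omega)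
    have := ih r' (by omega)
    rw [← h6] at this
    exact this

/-- Following a pipe upwards in a column. -/
theorem carry (P : PipeDream n) (c R0 : ℕ) : ∀ R, R0 ≤ R → R + c + 1 ≤ n →
    P.north R0 c = P.north R c ∨
      ∃ r, R0 ≤ r ∧ r < R ∧ P.west r (c + 1) = P.north R c := by
  intro R hR
  induction R, hR using Nat.le_induction with
  | base => intro _; exact Or.inl rfl
  | succ R hR ih =>
    intro h
    have hs := P.south_eq (r := R) (c := c) (by omega)
    cases hc : P.cross R c
    · right
      exact ⟨R, hR, by omega, by rw [P.west_succ_elbow hc, hs]⟩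
    · have e : P.north R c = P.north (R + 1) c := by rw [P.north_cross hc, hs]
      rw [← e]
      rcases ih (by omega) with h1 | ⟨r, h1, h2, h3⟩
      · exact Or.inl h1
      · exact Or.inr ⟨r, h1, by omega, h3⟩

/-- Pipe `x` enters column `c` above pipe `y`. -/
def Above (P : PipeDream n) (c x y : ℕ) : Prop :=
  ∃ r r', r < r' ∧ r' + c + 1 ≤ n ∧ P.west r c = x ∧ P.west r' c = y

theorem Above.not_symm {P : PipeDream n} {c x y : ℕ} (h : P.Above c x y) :
    ¬ P.Above c y x := by
  obtain ⟨r, r', h1, h2, h3, h4⟩ := h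
  rintro ⟨s, s', k1, k2, k3, k4⟩
  have e1 := P.colInj c r s' (by omega) k2 (by rw [h3, k4])
  have e2 := P.colInj c r' s h2 (by omega) (by rw [h4, k3])
  omega

theorem above_of_box (P : PipeDream n) {r c : ℕ} (h : r + c + 2 ≤ n) :
    P.Above c (P.west r c) (P.south r c) := by
  obtain ⟨r', h1, h2, h3⟩ := P.south_mem h
  exact ⟨r, r', h1, h2, rfl, h3.symm⟩

/-- After a crossing. -/
theorem after_cross (P : PipeDream n) {r c : ℕ} (h : P.cross r c = true) :
    P.exitPipe c = P.south r c ∨ P.Above (c + 1) (P.south r c) (P.west r c) := by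
  have hv := P.inShape r c h
  rcases P.carry c 0 r (by omega) (by omega) with h1 | ⟨r', h1, h2, h3⟩
  · left; rw [exit_eq, h1, P.north_cross h]
  · right
    exact ⟨r', r, h2, by omega, by rw [h3, P.north_cross h], P.west_succ_cross h⟩

/-- Where the pipe entering row `r2` goes, seen from row `r1 < r2`. -/
theorem lower_pipe (P : PipeDream n) {c r1 r2 : ℕ} (h : r1 < r2) (hv : r2 + c + 1 ≤ n) :
    P.south r1 c = P.west r2 c ∨
      ∃ r, r1 < r ∧ r + c + 2 ≤ n ∧ P.west r (c + 1) = P.west r2 c := by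
  cases hc : P.cross r2 c
  · rcases P.carry c (r1 + 1) r2 h hv with h1 | ⟨r, h1, h2, h3⟩
    · left; rw [P.south_eq (by omega), h1, P.north_elbow hc]
    · right; exact ⟨r, h1, by omega, by rw [h3, P.north_elbow hc]⟩
  · right
    exact ⟨r2, h, P.inShape _ _ hc, P.west_succ_cross hc⟩

theorem step_cross (P : PipeDream n) {c r1 r2 : ℕ} (h : r1 < r2) (hv : r2 + c + 1 ≤ n)
    (hc : P.cross r1 c = true) :
    P.south r1 c = P.west r2 c ∨ P.Above (c + 1) (P.west r1 c) (P.west r2 c) := by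
  rcases P.lower_pipe h hv with h1 | ⟨r, h1, h2, h3⟩
  · exact Or.inl h1
  · exact Or.inr ⟨r1, r, h1, by omega, P.west_succ_cross hc, h3⟩

theorem step (P : PipeDream n) {c x y : ℕ} (h : P.Above c x y) :
    (∃ r, P.cross r c = true ∧ P.west r c = x ∧ P.south r c = y) ∨
      P.Above (c + 1) x y ∨ P.exitPipe c = x := by
  obtain ⟨r1, r2, h1, h2, rfl, rfl⟩ := h
  cases hc : P.cross r1 c
  · right
    rcases P.carry c 0 r1 (by omega) (by omega) with h3 | ⟨r, h3, h4, h5⟩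
    · right; rw [exit_eq, h3, P.north_elbow hc]
    · left
      rw [P.north_elbow hc] at h5
      rcases P.lower_pipe h1 h2 with h6 | ⟨r', h6, h7, h8⟩
      · exact ⟨r, r1, h4, by omega, h5, by rw [P.west_succ_elbow hc, h6]⟩
      · exact ⟨r, r', by omega, by omega, h5, h8⟩
  · rcases P.step_cross h1 h2 hc with h3 | h3
    · exact Or.inl ⟨r1, hc, rfl, h3⟩
    · exact Or.inr (Or.inl h3)

theorem Above.lt {P : PipeDream n} {c x y : ℕ} (h : P.Above c x y) : c + 2 ≤ n := by
  obtain ⟨r1, r2, h1, h2, _⟩ := h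
  omega

end PipeDream

/-- The inverse of a permutation, on natural numbers. -/
def pinv {n : ℕ} (σ : Equiv.Perm (Fin n)) (v : ℕ) : ℕ :=
  if h : v < n then (σ⁻¹ ⟨v, h⟩).val else n

section
variable {n : ℕ}

theorem pinv_val (σ : Equiv.Perm (Fin n)) (i : Fin n) : pinv σ i.val = (σ⁻¹ i).val := by
  simp [pinv]

theorem pinv_lt (σ : Equiv.Perm (Fin n)) {v : ℕ} (h : v < n) : pinv σ v < n := by
  simp [pinv, h]

theorem pinv_inj (σ : Equiv.Perm (Fin n)) {v w : ℕ} (hv : v < n) (hw : w < n)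
    (h : pinv σ v = pinv σ w) : v = w := by
  simp only [pinv, hv, hw, dif_pos] at h
  have := σ⁻¹.injective (Fin.ext h)
  simpa using this

theorem WeakLE.nat {π ω : Equiv.Perm (Fin n)} (h : WeakLE π ω) {a b : ℕ} (hab : a < b)
    (hb : b < n) (hp : pinv π b < pinv π a) : pinv ω b < pinv ω a := by
  have ha : a < n := by omega
  have := h ⟨a, ha⟩ ⟨b, hb⟩ hab
  simp only [pinv, ha, hb, dif_pos] at hp ⊢
  exact this hp

theorem exists_pinv (σ : Equiv.Perm (Fin n)) {c : ℕ} (hc : c < n) :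
    ∃ v, v < n ∧ pinv σ v = c := by
  refine ⟨(σ ⟨c, hc⟩).val, Fin.isLt _, ?_⟩
  rw [pinv_val]; simp

end

namespace PipeDream
variable {n : ℕ}

theorem HasExitPerm.pinv {P : PipeDream n} {ω : Equiv.Perm (Fin n)} (h : P.HasExitPerm ω)
    {c : ℕ} (hc : c < n) : pinv ω (P.exitPipe c) = c := by
  have := h ⟨c, hc⟩
  simp only at this
  rw [this, pinv_val]; simp

theorem HasExitPerm.exit {P : PipeDream n} {ω : Equiv.Perm (Fin n)} (h : P.HasExitPerm ω)
    {v : ℕ} (hv : v < n) : P.exitPipe (_root_.pinv ω v) = v := by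
  have h1 := h.pinv (pinv_lt ω hv)
  exact pinv_inj ω (by rw [exit_eq]; exact P.north_lt (by have := pinv_lt ω hv; omega)) hv h1

theorem HasExitPerm.le {P : PipeDream n} {ω : Equiv.Perm (Fin n)} (h : P.HasExitPerm ω)
    {r c : ℕ} (hv : r + c + 1 ≤ n) : c ≤ _root_.pinv ω (P.west r c) := by
  by_contra hlt
  have h1 := h.exit (P.west_lt c r hv)
  obtain ⟨d, hd⟩ : ∃ d, c = _root_.pinv ω (P.west r c) + d + 1 := 
    ⟨c - 1 - _root_.pinv ω (P.west r c), by omega⟩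
  have := P.exit_ne (_root_.pinv ω (P.west r c)) d r (by omega)
  rw [← hd] at this
  exact this h1.symm

theorem lemma_exit {P : PipeDream n} {ω : Equiv.Perm (Fin n)} (h : P.HasExitPerm ω)
    {x y : ℕ} : ∀ d c, n ≤ c + d → P.Above c x y → _root_.pinv ω x < _root_.pinv ω y ∨
      ∃ c' r, c ≤ c' ∧ P.cross r c' = true ∧ P.west r c' = x ∧ P.south r c' = y := by
  intro d
  induction d with
  | zero => intro c hc hA; have := hA.lt; omega
  | succ d ih =>
    intro c hc hA
    rcases P.step hA with ⟨r, h1⟩ | h1 | h1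
    · exact Or.inr ⟨c, r, le_rfl, h1⟩
    · rcases ih (c + 1) (by omega) h1 with h2 | ⟨c', r, h2, h3⟩
      · exact Or.inl h2
      · exact Or.inr ⟨c', r, by omega, h3⟩
    · left
      have hlt := hA.lt
      have e := h.pinv (c := c) (by omega)
      obtain ⟨r1, r2, k1, k2, k3, k4⟩ := hA
      rw [h1] at e
      have l := h.le k2
      rw [k4] at l
      rcases Nat.eq_or_lt_of_le l with h5 | h5
      · exfalso
        have : x = y := pinv_inj ω (by rw [← k3]; exact P.west_lt _ _ (by omega))
          (by rw [← k4]; exact P.west_lt _ _ (by omega)) (by rw [e, ← h5])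
        have := P.colInj c r1 r2 (by omega) k2 (by rw [k3, k4, this])
        omega
      · omega

theorem LinExt.nat {P : PipeDream n} {π : Equiv.Perm (Fin n)} (h : P.LinExt π)
    {r c : ℕ} (hv : r + c + 2 ≤ n) (hc : P.cross r c = false) :
    pinv π (P.west r c) < pinv π (P.south r c) := by
  have := h ⟨_, P.west_lt c r (by omega)⟩ ⟨_, P.south_lt hv⟩ ⟨r, c, hv, hc, rfl, rfl⟩
  simpa [_root_.pinv, P.west_lt c r (by omega), P.south_lt hv] using this

theorem LinExt.north_mono {P : PipeDream n} {π : Equiv.Perm (Fin n)} (h : P.LinExt π)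
    (c R0 : ℕ) : ∀ R, R0 ≤ R → R + c + 1 ≤ n →
    pinv π (P.north R0 c) ≤ pinv π (P.north R c) := by
  intro R hR
  induction R, hR using Nat.le_induction with
  | base => intro _; exact le_rfl
  | succ R hR ih =>
    intro hv
    have hs := P.south_eq (r := R) (c := c) (by omega)
    refine (ih (by omega)).trans ?_
    rw [← hs]
    cases hc : P.cross R c
    · rw [P.north_elbow hc]; exact (h.nat (by omega) hc).le
    · rw [P.north_cross hc]

theorem lemma_path {P : PipeDream n} {π : Equiv.Perm (Fin n)} (h : P.LinExt π)
    (hred : P.Reduced) :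
    ∀ d c x y, n ≤ c + d → P.Above c x y → _root_.pinv π x < _root_.pinv π y ∨
      ∃ c' r, c ≤ c' ∧ P.cross r c' = true ∧ P.west r c' = x ∧ P.south r c' = y := by
  intro d
  induction d with
  | zero => intro c x y hc hA; have := hA.lt; omega
  | succ d ih =>
    intro c x y hc hA
    obtain ⟨r1, r2, h1, h2, rfl, rfl⟩ := hA
    cases hc1 : P.cross r1 c
    · left
      have a1 := h.nat (r := r1) (c := c) (by omega) hc1
      have a2 := h.north_mono c (r1 + 1) r2 h1 h2
      rw [← P.south_eq (by omega)] at a2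
      cases hc2 : P.cross r2 c
      · rw [P.north_elbow hc2] at a2; omega
      · have hv := P.inShape _ _ hc2
        have hab : P.Above (c + 1) (P.north r2 c) (P.west r2 c) := by
          rcases P.carry c (r1 + 1) r2 h1 h2 with h3 | ⟨r, h3, h4, h5⟩
          · exact ⟨r1, r2, h1, by omega,
              by rw [P.west_succ_elbow hc1, P.south_eq (by omega), h3], P.west_succ_cross hc2⟩
          · exact ⟨r, r2, h4, by omega, h5, P.west_succ_cross hc2⟩
        rcases ih (c + 1) _ _ (by omega) hab with h3 | ⟨c', r, h3, h4, h5, h6⟩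
        · omega
        · exfalso
          refine hred r2 c r c' hc2 h4 (fun he => ?_) (Or.inr ⟨h6.symm, ?_⟩)
          · have := (Prod.mk.inj he).2; omega
          · rw [h5, P.north_cross hc2]
    · rcases P.step_cross h1 h2 hc1 with h3 | h3
      · exact Or.inr ⟨c, r1, le_rfl, hc1, rfl, h3⟩
      · rcases ih (c + 1) _ _ (by omega) h3 with h2 | ⟨c', r, h2, h3⟩
        · exact Or.inl h2
        · exact Or.inr ⟨c', r, by omega, h3⟩

/-- The local rule satisfied by the pipe dream associated with `π ≤ ω`. -/
def Rule (P : PipeDream n) (π ω : Equiv.Perm (Fin n)) : Prop :=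
  ∀ r c, P.cross r c = true ↔ r + c + 2 ≤ n ∧
    (pinv ω (P.south r c) = c ∨ pinv π (P.south r c) < pinv π (P.west r c))

theorem no_recross {P : PipeDream n} (hred : P.Reduced) {r c r' c' : ℕ}
    (h1 : P.cross r c = true) (h2 : P.cross r' c' = true) (hc : c < c')
    (hw : P.west r' c' = P.south r c) (hs : P.south r' c' = P.west r c) : False := by
  refine hred r c r' c' h1 h2 (fun he => ?_) (Or.inr ⟨hs.symm, hw.symm⟩)
  have := (Prod.mk.inj he).2; omega

theorem rule_of_linExt {P : PipeDream n} {π ω : Equiv.Perm (Fin n)} (hred : P.Reduced)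
    (hex : P.HasExitPerm ω) (h : P.LinExt π) : P.Rule π ω := by
  intro r c
  constructor
  · intro hc
    have hv := P.inShape _ _ hc
    refine ⟨hv, ?_⟩
    rcases P.after_cross hc with h1 | h1
    · left; rw [← h1]; exact hex.pinv (by omega)
    · right
      rcases lemma_path h hred n (c + 1) _ _ (by omega) h1 with h2 | ⟨c', r', h2, h3, h4, h5⟩
      · exact h2
      · exact (no_recross hred hc h3 (by omega) h4 h5).elim
  · rintro ⟨hv, h1⟩
    by_contra hc
    have hc : P.cross r c = false := by simpa using hc
    rcases h1 with h1 | h1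
    · have := hex.le (r := r) (c := c + 1) (by omega)
      rw [P.west_succ_elbow hc, h1] at this
      omega
    · have := h.nat hv hc
      omega

theorem weakLE_of_linExt {P : PipeDream n} {π ω : Equiv.Perm (Fin n)} (hred : P.Reduced)
    (hex : P.HasExitPerm ω) (h : P.LinExt π) : WeakLE π ω := by
  intro i j hij hp
  have hA : P.Above 0 i.val j.val :=
    ⟨i, j, hij, by have := j.isLt; omega, P.west_zero _, P.west_zero _⟩
  rcases lemma_path h hred n 0 _ _ (by omega) hA with h1 | ⟨c, r, h1, h2, h3, h4⟩
  · rw [pinv_val, pinv_val] at h1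
    exact absurd hp (not_lt.mpr (le_of_lt h1))
  · have hv := P.inShape _ _ h2
    have goal : pinv ω j.val < pinv ω i.val := by
      rcases P.after_cross h2 with h5 | h5
      · have e := hex.pinv (c := c) (by omega)
        rw [h5, h4] at e
        have := hex.le (r := r) (c := c + 1) (by omega)
        rw [P.west_succ_cross h2, h3] at this
        omega
      · rcases lemma_exit hex n (c + 1) (by omega) h5 with h6 | ⟨c', r', h6, h7, h8, h9⟩
        · rwa [h3, h4] at h6
        · exact (no_recross hred h2 h7 (by omega) h8 h9).elim
    rw [pinv_val, pinv_val] at goal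
    exact goal

theorem eq_of_rule {P P' : PipeDream n} {π ω : Equiv.Perm (Fin n)} (h : P.Rule π ω)
    (h' : P'.Rule π ω) : P = P' := by
  have key : ∀ m r c, (n - r) + c ≤ m → 
      (r + c + 1 ≤ n → P.west r c = P'.west r c) ∧ (r + c + 2 ≤ n → P.south r c = P'.south r c) ∧
        P.cross r c = P'.cross r c := by
    intro m
    induction m with
    | zero =>
      intro r c hm
      have hc : c = 0 := by omega
      subst hc
      refine ⟨fun _ => by simp [west_zero], fun h => by omega, ?_⟩
      rw [P.elbow_half (by omega), P'.elbow_half (by omega)]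
    | succ m ih =>
      intro r c hm
      by_cases hv : r + c + 1 ≤ n
      · have hw : P.west r c = P'.west r c := by
          cases c with
          | zero => simp [west_zero]
          | succ c =>
            obtain ⟨a1, a2, a3⟩ := ih r c (by omega)
            rw [west_succ, west_succ, a1 (by omega), a2 (by omega), a3]
        have hs : r + c + 2 ≤ n → P.south r c = P'.south r c := by
          intro hv2
          obtain ⟨a1, a2, a3⟩ := ih (r + 1) c (by omega)
          rw [P.south_eq hv2, P'.south_eq hv2]
          cases hc : P.cross (r + 1) c
          · rw [P.north_elbow hc, P'.north_elbow (by rw [← a3, hc]), a1 (by omega)]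
          · rw [P.north_cross hc, P'.north_cross (by rw [← a3, hc]), a2 (P.inShape _ _ hc)]
        refine ⟨fun _ => hw, hs, ?_⟩
        by_cases hv2 : r + c + 2 ≤ n
        · rw [Bool.eq_iff_iff, h r c, h' r c, hw, hs hv2]
        · rw [P.elbow_half hv2, P'.elbow_half hv2]
      · have hcr : P.cross r c = P'.cross r c := by
          rw [P.elbow_half (by omega), P'.elbow_half (by omega)]
        exact ⟨fun h => by omega, fun h => by omega, hcr⟩
  have hcross : P.cross = P'.cross := by
    funext r c
    exact (key _ r c le_rfl).2.2
  cases P; cases P'; simpa using hcross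

theorem acyclic_of_linExt {P : PipeDream n} {π : Equiv.Perm (Fin n)} (h : P.LinExt π) :
    P.Acyclic := by
  have key : ∀ i j, Relation.TransGen P.Arc i j → pinv π i < pinv π j := by
    intro i j hij
    induction hij with
    | single h1 =>
      obtain ⟨r, c, h1, h2, rfl, rfl⟩ := h1
      exact h.nat h1 h2
    | tail _ h1 ih =>
      obtain ⟨r, c, h1, h2, rfl, rfl⟩ := h1
      exact ih.trans (h.nat h1 h2)
  intro i hi
  exact lt_irrefl _ (key i i hi)

end PipeDream

theorem exists_rank {α : Type*} [Fintype α] {n : ℕ} (hn : Fintype.card α = n)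
    (R : α → α → Prop) (hR : ∀ a, ¬ Relation.TransGen R a a) :
    ∃ e : α ≃ Fin n, ∀ a b, R a b → e a < e b := by
  classical
  let s : α → α → Prop := Relation.ReflTransGen R
  haveI : IsPartialOrder α s :=
    { refl := fun a => Relation.ReflTransGen.refl
      trans := fun a b c h1 h2 => h1.trans h2
      antisymm := by
        intro a b h1 h2
        by_contra hne
        rcases Relation.reflTransGen_iff_eq_or_transGen.mp h1 with h3 | h3
        · exact hne h3.symm
        · exact hR a (h3.trans_left h2) }
  obtain ⟨t, ht, hst⟩ := extend_partialOrder s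
  letI : LinearOrder α :=
    { le := t
      le_refl := fun a => refl_of t a
      le_trans := fun a b c h1 h2 => trans_of t h1 h2
      le_antisymm := fun a b h1 h2 => antisymm_of t h1 h2
      le_total := fun a b => total_of t a b
      toDecidableLE := Classical.decRel _ }
  let e := Fintype.orderIsoFinOfCardEq α hn
  refine ⟨e.symm.toEquiv, fun a b hab => ?_⟩
  have hle : a ≤ b := hst a b (Relation.ReflTransGen.single hab)
  have hne : a ≠ b := by
    rintro rfl
    exact hR a (Relation.TransGen.single hab)
  exact e.symm.strictMono (lt_of_le_of_ne hle hne)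

namespace PipeDream
variable {n : ℕ}

theorem exists_linExt {P : PipeDream n} (h : P.Acyclic) :
    ∃ π : Equiv.Perm (Fin n), P.LinExt π := by
  obtain ⟨e, he⟩ := exists_rank (α := Fin n) (n := n) (by simp)
    (fun i j => P.Arc i.val j.val) (by
      intro a ha
      exact h a.val (Relation.TransGen.lift (fun i : Fin n => i.val) (fun _ _ h => h) _ _ ha))
  refine ⟨e⁻¹, fun i j hij => ?_⟩
  rw [inv_inv]
  exact he i j hij

end PipeDream

namespace PipeDream
variable {n : ℕ}

/-- The tile chosen by the local rule. -/
def ruleTile (π ω : Equiv.Perm (Fin n)) (r c : ℕ) (ws : ℕ × ℕ) : Bool :=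
  decide (r + c + 2 ≤ n ∧ (pinv ω ws.2 = c ∨ pinv π ws.2 < pinv π ws.1))

/-- The pipes of the pipe dream built with the local rule. -/
def rulePipes (π ω : Equiv.Perm (Fin n)) : ℕ → ℕ → ℕ × ℕ
  | r, c =>
    (if hc : c = 0 then r
      else if ruleTile π ω r (c - 1) (rulePipes π ω r (c - 1)) then
        (rulePipes π ω r (c - 1)).1 else (rulePipes π ω r (c - 1)).2,
     if hr : r + c + 2 ≤ n then
        if ruleTile π ω (r + 1) c (rulePipes π ω (r + 1) c) then
          (rulePipes π ω (r + 1) c).2 else (rulePipes π ω (r + 1) c).1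
      else 0)
  termination_by r c => (n - r) + c
  decreasing_by all_goals omega

/-- The pipe dream built with the local rule. -/
def ruleDream (π ω : Equiv.Perm (Fin n)) : PipeDream n where
  cross r c := ruleTile π ω r c (rulePipes π ω r c)
  inShape r c h := by
    simp only [ruleTile, decide_eq_true_eq] at h
    exact h.1

theorem ruleDream_cross (π ω : Equiv.Perm (Fin n)) (r c : ℕ) :
    (ruleDream π ω).cross r c = ruleTile π ω r c (rulePipes π ω r c) := rfl

theorem rulePipes_eq (π ω : Equiv.Perm (Fin n)) : ∀ m r c, (n - r) + c ≤ m →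
    (ruleDream π ω).pipes r c = rulePipes π ω r c := by
  intro m
  induction m with
  | zero =>
    intro r c h
    rw [pipes, rulePipes]
    have hc : c = 0 := by omega
    have hr : ¬ (r + c + 2 ≤ n) := by omega
    simp only [dif_pos hc, dif_neg hr]
  | succ m ih =>
    intro r c h
    rw [pipes, rulePipes]
    by_cases hc : c = 0 <;> by_cases hr : r + c + 2 ≤ n
    · rw [ih (r + 1) c (by omega)]
      simp only [dif_pos hc, dif_pos hr, ruleDream_cross]
      rfl
    · simp only [dif_pos hc, dif_neg hr]
    · rw [ih (r + 1) c (by omega), ih r (c - 1) (by omega)]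
      simp only [dif_neg hc, dif_pos hr, ruleDream_cross]
      rfl
    · rw [ih r (c - 1) (by omega)]
      simp only [dif_neg hc, dif_neg hr, ruleDream_cross]
      rfl

theorem ruleDream_rule (π ω : Equiv.Perm (Fin n)) : (ruleDream π ω).Rule π ω := by
  intro r c
  unfold west south
  rw [rulePipes_eq π ω _ r c le_rfl]
  simp [ruleDream, ruleTile]

/-- The invariants of column `c`. -/
structure ColInv (P : PipeDream n) (π ω : Equiv.Perm (Fin n)) (c : ℕ) : Prop where
  ge : ∀ r, r + c + 1 ≤ n → c ≤ pinv ω (P.west r c)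
  ex : ∀ v, v < n → c ≤ pinv ω v → ∃ r, r + c + 1 ≤ n ∧ P.west r c = v
  ord : ∀ r r', r < r' → r' + c + 1 ≤ n →
    pinv π (P.west r c) < pinv π (P.west r' c) ∨ P.west r c < P.west r' c

theorem colInv_zero (P : PipeDream n) (π ω : Equiv.Perm (Fin n)) : ColInv P π ω 0 where
  ge r h := by omega
  ex v hv _ := ⟨v, by omega, P.west_zero v⟩
  ord r r' h1 h2 := by right; simpa [west_zero] using h1

/-- What happens in column `c`: the pipe `ω c` enters in row `ρ` and exits. -/
theorem col_exit {P : PipeDream n} {π ω : Equiv.Perm (Fin n)} (hle : WeakLE π ω)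
    (hR : P.Rule π ω) {c : ℕ} (hc : c < n) (hI : ColInv P π ω c) :
    ∃ ρ, ρ + c + 1 ≤ n ∧ pinv ω (P.west ρ c) = c ∧ (∀ r, r < ρ → P.cross r c = true) ∧
      P.exitPipe c = P.west ρ c := by
  obtain ⟨k, hk, hkc⟩ := exists_pinv ω hc
  obtain ⟨ρ, hρ, rfl⟩ := hI.ex k hk hkc.ge
  have helb : P.cross ρ c = false := by
    by_contra hcr
    have hcr : P.cross ρ c = true := by simpa using hcr
    obtain ⟨hv, h⟩ := (hR ρ c).1 hcr
    have hne := P.west_ne_south hv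
    rcases h with h | h
    · exact hne (pinv_inj ω hk (P.south_lt hv) (by rw [h, hkc]))
    · obtain ⟨r', h1, h2, h3⟩ := P.south_mem hv
      rw [h3] at h hne
      rcases hI.ord ρ r' h1 h2 with h4 | h4
      · omega
      · have := hle.nat h4 (P.west_lt _ _ h2) h
        have := hI.ge r' h2
        omega
  have hnorth : ∀ d r, r + d = ρ → P.north r c = P.west ρ c := by
    intro d
    induction d with
    | zero => intro r hr; have : r = ρ := by omega
              subst this; exact P.north_elbow helb
    | succ d ih =>
      intro r hr
      have e := ih (r + 1) (by omega)
      have hv : r + c + 2 ≤ n := by omega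
      rw [← P.south_eq hv] at e
      have hx : P.cross r c = true := (hR r c).2 ⟨hv, Or.inl (by rw [e, hkc])⟩
      rw [P.north_cross hx, e]
  refine ⟨ρ, hρ, hkc, ?_, hnorth ρ 0 (by omega)⟩
  intro r hr
  have hv : r + c + 2 ≤ n := by omega
  refine (hR r c).2 ⟨hv, Or.inl ?_⟩
  rw [P.south_eq hv, hnorth (ρ - (r + 1)) (r + 1) (by omega), hkc]

theorem col_argmin {P : PipeDream n} {π ω : Equiv.Perm (Fin n)} 
    (hR : P.Rule π ω) {c ρ : ℕ} (hρ : ρ + c + 1 ≤ n) (hk : pinv ω (P.west ρ c) = c) :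
    ∀ R, R + c + 1 ≤ n → ρ ≤ R → ∀ r, R ≤ r → r + c + 1 ≤ n →
      pinv π (P.north R c) ≤ pinv π (P.west r c) := by
  apply row_induction
  · intro R hR' _ r h1 h2
    have : r = R := by omega
    subst this
    rw [P.north_elbow (P.elbow_half (by omega))]
  · intro R hv ih hρR r h1 h2
    have ih := ih (by omega)
    rw [← P.south_eq hv] at ih
    cases hc : P.cross R c
    · rw [P.north_elbow hc]
      rcases Nat.eq_or_lt_of_le h1 with h | h
      · subst h; exact le_rfl
      · have h3 := ih r h h2
        have h4 : ¬ pinv π (P.south R c) < pinv π (P.west R c) := by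
          intro h5
          have := (hR R c).2 ⟨hv, Or.inr h5⟩
          rw [hc] at this
          cases this
        omega
    · rw [P.north_cross hc]
      rcases Nat.eq_or_lt_of_le h1 with h | h
      · subst h
        rcases ((hR R c).1 hc).2 with h5 | h5
        · exfalso
          obtain ⟨r', k1, k2, k3⟩ := P.south_mem hv
          have e := pinv_inj ω (P.south_lt hv) (P.west_lt _ _ hρ) (by rw [h5, hk])
          have := P.colInj c r' ρ k2 hρ (by rw [← k3, e])
          omega
        · exact h5.le
      · exact ih r h h2

theorem colInv_succ {P : PipeDream n} {π ω : Equiv.Perm (Fin n)} (hle : WeakLE π ω)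
    (hR : P.Rule π ω) {c : ℕ} (hc : c < n) (hI : ColInv P π ω c) : ColInv P π ω (c + 1) := by
  obtain ⟨ρ, hρ, hk, hcr, hex⟩ := col_exit hle hR hc hI
  refine ⟨?_, ?_, ?_⟩
  · intro r hv
    have h1 := P.exit_ne_succ (r := r) (c := c) (by omega)
    obtain ⟨r', k1, k2, k3⟩ := P.west_succ_mem (r := r) (c := c) (by omega)
    have h2 := hI.ge r' k2
    rw [← k3] at h2
    rcases Nat.eq_or_lt_of_le h2 with h | h
    · exfalso
      apply h1
      rw [hex]
      exact pinv_inj ω (P.west_lt _ _ hv) (P.west_lt _ _ hρ) (by rw [hk, ← h])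
    · exact h
  · intro v hv h
    obtain ⟨r, h1, rfl⟩ := hI.ex v hv (by omega)
    cases hx : P.cross r c
    · rcases P.carry c 0 r (by omega) h1 with h2 | ⟨r', h2, h3, h4⟩
      · rw [← exit_eq, hex, P.north_elbow hx] at h2
        rw [← h2] at h
        omega
      · exact ⟨r', by omega, by rw [h4, P.north_elbow hx]⟩
    · exact ⟨r, by have := P.inShape _ _ hx; omega, P.west_succ_cross hx⟩
  · intro r r' h1 h2
    obtain ⟨r'', k1, k2, k3⟩ := P.west_succ_mem (r := r') (c := c) (by omega)
    cases hx : P.cross r c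
    · left
      have hρr : ρ ≤ r := by
        by_contra hlt
        have := hcr r (by omega)
        rw [hx] at this
        cases this
      have h3 := col_argmin hR hρ hk (r + 1) (by omega) (by omega) r'' (by omega) k2
      rw [← P.south_eq (by omega), ← P.west_succ_elbow hx, ← k3] at h3
      refine lt_of_le_of_ne h3 fun he => ?_
      have := pinv_inj π (P.west_lt _ _ (by omega)) (P.west_lt _ _ (by omega)) he
      have := P.colInj (c + 1) r r' (by omega) (by omega) this
      omega
    · rw [P.west_succ_cross hx, k3]
      exact hI.ord r r'' (by omega) k2

theorem colInv {P : PipeDream n} {π ω : Equiv.Perm (Fin n)} (hle : WeakLE π ω)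
    (hR : P.Rule π ω) : ∀ c, c ≤ n → ColInv P π ω c := by
  intro c
  induction c with
  | zero => intro _; exact colInv_zero P π ω
  | succ c ih => intro hc; exact colInv_succ hle hR (by omega) (ih (by omega))

theorem rule_exit {P : PipeDream n} {π ω : Equiv.Perm (Fin n)} (hle : WeakLE π ω)
    (hR : P.Rule π ω) : P.HasExitPerm ω := by
  intro c
  obtain ⟨ρ, hρ, hk, _, hex⟩ := col_exit hle hR c.isLt (colInv hle hR c c.isLt.le)
  rw [hex]
  refine pinv_inj ω (P.west_lt _ _ hρ) (Fin.isLt _) ?_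
  rw [hk, pinv_val]; simp

theorem rule_cross_lt {P : PipeDream n} {π ω : Equiv.Perm (Fin n)} (hle : WeakLE π ω)
    (hR : P.Rule π ω) {r c : ℕ} (hx : P.cross r c = true) : P.west r c < P.south r c := by
  obtain ⟨hv, h⟩ := (hR r c).1 hx
  have hI := colInv hle hR c (by omega)
  have hne := P.west_ne_south hv
  obtain ⟨r', h1, h2, h3⟩ := P.south_mem hv
  have ho := hI.ord r r' h1 h2
  rw [← h3] at ho
  rcases ho with ho | ho
  · rcases h with h | h
    · by_contra hlt
      have := hle.nat (a := P.south r c) (b := P.west r c) (by omega)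
        (P.west_lt _ _ (by omega)) ho
      have := hI.ge r (by omega)
      omega
    · omega
  · exact ho

theorem rule_linExt {P : PipeDream n} {π ω : Equiv.Perm (Fin n)}
    (hR : P.Rule π ω) : P.LinExt π := by
  rintro i j ⟨r, c, hv, hx, hi, hj⟩
  have h1 : ¬ pinv π (P.south r c) < pinv π (P.west r c) := by
    intro h5
    have := (hR r c).2 ⟨hv, Or.inr h5⟩
    rw [hx] at this
    cases this
  have hne := P.west_ne_south hv
  have h2 : pinv π (P.west r c) ≠ pinv π (P.south r c) := fun he =>
    hne (pinv_inj π (P.west_lt _ _ (by omega)) (P.south_lt hv) he)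
  rw [hi, hj, pinv_val, pinv_val] at h1 h2
  rw [Fin.lt_def]
  omega

theorem rule_persist {P : PipeDream n} {π ω : Equiv.Perm (Fin n)} (hle : WeakLE π ω)
    (hR : P.Rule π ω) {c s a : ℕ} (has : a < s) (hA : P.Above c s a) :
    ∀ c', c ≤ c' → P.Above c' s a ∨ pinv ω s < c' := by
  intro c' hc'
  induction c', hc' using Nat.le_induction with
  | base => exact Or.inl hA
  | succ c' hc' ih =>
    rcases ih with ih | ih
    · rcases P.step ih with ⟨r, h1, h2, h3⟩ | h1 | h1
      · have := rule_cross_lt hle hR h1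
        omega
      · exact Or.inl h1
      · right
        have := ih.lt
        rw [← h1, (rule_exit hle hR).pinv (by omega)]
        omega
    · right; omega

theorem rule_no_recross {P : PipeDream n} {π ω : Equiv.Perm (Fin n)} (hle : WeakLE π ω)
    (hR : P.Rule π ω) {r c r' c' : ℕ} (h1 : P.cross r c = true) (h2 : P.cross r' c' = true)
    (hc : c < c') (hw : P.west r c = P.west r' c') (hs : P.south r c = P.south r' c') :
    False := by
  have hex := rule_exit hle hR
  have hv' := P.inShape _ _ h2
  have hge : c' ≤ pinv ω (P.south r c) := by
    rw [hs]
    obtain ⟨r'', k1, k2, k3⟩ := P.south_mem hv'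
    rw [k3]; exact hex.le k2
  rcases P.after_cross h1 with h3 | h3
  · rw [← h3, hex.pinv (by omega)] at hge
    omega
  · rcases rule_persist hle hR (rule_cross_lt hle hR h1) h3 c' (by omega) with h4 | h4
    · rw [hw, hs] at h4
      exact h4.not_symm (P.above_of_box hv')
    · omega

theorem rule_reduced {P : PipeDream n} {π ω : Equiv.Perm (Fin n)} (hle : WeakLE π ω)
    (hR : P.Rule π ω) : P.Reduced := by
  intro r c r' c' h1 h2 hne h
  have l1 := rule_cross_lt hle hR h1
  have l2 := rule_cross_lt hle hR h2
  have v1 := P.inShape _ _ h1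
  have v2 := P.inShape _ _ h2
  rcases h with ⟨hw, hs⟩ | ⟨hw, hs⟩
  · rcases Nat.lt_trichotomy c c' with h | h | h
    · exact rule_no_recross hle hR h1 h2 h hw hs
    · subst h
      have := P.colInj c r r' (by omega) (by omega) hw
      exact hne (by rw [this])
    · exact rule_no_recross hle hR h2 h1 h hw.symm hs.symm
  · omega

end PipeDream

/-- For any permutation `ω ∈ S_n`, the sets `L(P)`, for `P` ranging
over the acyclic reduced pipe dreams of `Π(ω)`, are pairwise disjoint, all nonempty,
and their union is exactly the weak order interval `[e, ω]`. -/
theorem pipeDream_linExt_partition (n : ℕ) (ω : Equiv.Perm (Fin n)) :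
    (∀ P P' : PipeDream n,
      P.Reduced → P.HasExitPerm ω → P.Acyclic →
      P'.Reduced → P'.HasExitPerm ω → P'.Acyclic → P ≠ P' →
      ∀ π : Equiv.Perm (Fin n), P.LinExt π → ¬ P'.LinExt π) ∧
    (∀ P : PipeDream n, P.Reduced → P.HasExitPerm ω → P.Acyclic →
      ∃ π : Equiv.Perm (Fin n), P.LinExt π) ∧
    (∀ π : Equiv.Perm (Fin n),
      WeakLE π ω ↔
        ∃ P : PipeDream n, P.Reduced ∧ P.HasExitPerm ω ∧ P.Acyclic ∧ P.LinExt π) := by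
  refine ⟨?_, ?_, ?_⟩
  · intro P P' h1 h2 _ h1' h2' _ hne π hπ hπ'
    exact hne (PipeDream.eq_of_rule (PipeDream.rule_of_linExt h1 h2 hπ)
      (PipeDream.rule_of_linExt h1' h2' hπ'))
  · intro P _ _ h
    exact PipeDream.exists_linExt h
  · intro π
    constructor
    · intro hle
      have hR := PipeDream.ruleDream_rule π ω
      have hL := PipeDream.rule_linExt hR
      exact ⟨PipeDream.ruleDream π ω, PipeDream.rule_reduced hle hR,
        PipeDream.rule_exit hle hR, PipeDream.acyclic_of_linExt hL, hL⟩
    · rintro ⟨P, h1, h2, _, h4⟩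
      exact PipeDream.weakLE_of_linExt h1 h2 h4
end

section
/- Let σ, σ′ ∈ [e,ω] with σ ≤ σ′ in the weak order, and let C and C′ be the ≡_ω-congruence classes of σ and σ′ respectively (each class is a weak order interval, so it has a minimum and a maximum). Then min(C) ≤ min(C′) and max(C) ≤ max(C′) in the weak order. -/
namespace PDComb

variable {α : Type} [LinearOrder α] {n : ℕ}

/-- weak order in terms of position functions -/
def LE' (g h : α ≃ Fin n) : Prop := ∀ i j : α, i < j → g j < g i → h j < h i

/-- linear extensions of an abstract family of relations -/
def Lx {O : Type} (Arc : O → α → α → Prop) (P : O) (g : α ≃ Fin n) : Prop :=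
  ∀ i j : α, Arc P i j → g i < g j

/-- exchange the positions of two labels -/
def sw (g : α ≃ Fin n) (c d : α) : α ≃ Fin n := (Equiv.swap c d).trans g

lemma sw_left (g : α ≃ Fin n) (c d : α) : sw g c d c = g d := by simp [sw]
lemma sw_right (g : α ≃ Fin n) (c d : α) : sw g c d d = g c := by simp [sw]
lemma sw_other (g : α ≃ Fin n) {c d u : α} (h : u ≠ c) (h' : u ≠ d) : sw g c d u = g u := by
  simp [sw, Equiv.swap_apply_of_ne_of_ne h h']

lemma ne_val (g : α ≃ Fin n) {u v : α} (h : u ≠ v) : (g u).val ≠ (g v).val := by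
  intro h'; exact h (g.injective (Fin.ext h'))

lemma LE'.trans {g h k : α ≃ Fin n} (a : LE' g h) (b : LE' h k) : LE' g k :=
  fun i j hij hg => b i j hij (a i j hij hg)

/-- comparing before and after an adjacent exchange -/
lemma sw_lt_iff (g : α ≃ Fin n) {c d u v : α} (hcd : (g d).val + 1 = (g c).val)
    (h1 : ¬ (u = d ∧ v = c)) (h2 : ¬ (u = c ∧ v = d)) :
    sw g c d u < sw g c d v ↔ g u < g v := by
  have hne : c ≠ d := by rintro rfl; omega
  simp only [Fin.lt_def]
  by_cases huc : u = c
  · subst huc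
    have hvd : v ≠ d := fun h => h2 ⟨rfl, h⟩
    rw [sw_left]
    by_cases hvu : v = u
    · subst hvu; rw [sw_left]; omega
    · rw [sw_other g hvu hvd]
      have := ne_val g hvu; have := ne_val g hvd; omega
  · by_cases hud : u = d
    · subst hud
      have hvc : v ≠ c := fun h => h1 ⟨rfl, h⟩
      rw [sw_right]
      by_cases hvu : v = u
      · subst hvu; rw [sw_right]; omega
      · rw [sw_other g hvc hvu]
        have := ne_val g hvu; have := ne_val g hvc; omega
    · rw [sw_other g huc hud]
      have := ne_val g huc; have := ne_val g hud
      by_cases hvc : v = c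
      · subst hvc; rw [sw_left]; omega
      · by_cases hvd : v = d
        · subst hvd; rw [sw_right]; omega
        · rw [sw_other g hvc hvd]

lemma sw_le (g : α ≃ Fin n) {c d : α} (hlt : c < d) (hcd : (g d).val + 1 = (g c).val) :
    LE' (sw g c d) g := by
  intro i j hij h
  by_cases h2 : j = d ∧ i = c
  · obtain ⟨rfl, rfl⟩ := h2
    rw [Fin.lt_def]; omega
  · refine (sw_lt_iff g hcd h2 ?_).1 h
    rintro ⟨rfl, rfl⟩; exact absurd hij (not_lt.2 hlt.le)

lemma le_sw {s g : α ≃ Fin n} {c d : α} (hlt : c < d) (hcd : (g d).val + 1 = (g c).val)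
    (hs : LE' s g) (hscd : s c < s d) : LE' s (sw g c d) := by
  intro i j hij h
  by_cases h2 : j = d ∧ i = c
  · obtain ⟨rfl, rfl⟩ := h2
    exact absurd h (not_lt.2 hscd.le)
  · refine (sw_lt_iff g hcd h2 ?_).2 (hs i j hij h)
    rintro ⟨rfl, rfl⟩; exact absurd hij (not_lt.2 hlt.le)

/-- two arrangements of the same block of three consecutive positions, the first of which is
increasing -/
lemma hex_le {k h t : α ≃ Fin n} {x y z : α} (hxy : x < y) (hyz : y < z)
    (t1 : (t z).val + 1 = (t y).val) (t2 : (t y).val + 1 = (t x).val)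
    (ko : ∀ u, u ≠ x → u ≠ y → u ≠ z → k u = t u ∧ h u = t u)
    (kx : k x = t z) (ky : k y = t y) (kz : k z = t x)
    (hx : (t z).val ≤ h x ∧ (h x).val ≤ t x) (hy : (t z).val ≤ h y ∧ (h y).val ≤ t x)
    (hz : (t z).val ≤ h z ∧ (h z).val ≤ t x) : LE' k h := by
  have inb : ∀ u, (u = x ∨ u = y ∨ u = z) → (t z).val ≤ h u ∧ (h u).val ≤ t x ∧
      (t z).val ≤ k u ∧ (k u).val ≤ t x := by
    rintro u (rfl | rfl | rfl)
    · rw [kx]; omega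
    · rw [ky]; omega
    · rw [kz]; omega
  have outb : ∀ u, ¬ (u = x ∨ u = y ∨ u = z) → k u = t u ∧ h u = t u ∧
      ((t u).val < t z ∨ (t x).val < t u) := by
    intro u hu
    push Not at hu
    have a1 := ne_val t hu.1
    have a2 := ne_val t hu.2.1
    have a3 := ne_val t hu.2.2
    have a4 := ko u hu.1 hu.2.1 hu.2.2
    exact ⟨a4.1, a4.2, by omega⟩
  intro i j hij hk
  rw [Fin.lt_def] at hk ⊢
  by_cases hi : i = x ∨ i = y ∨ i = z
  · by_cases hj : j = x ∨ j = y ∨ j = z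
    · exfalso
      have hxz := hxy.trans hyz
      rcases hi with rfl | rfl | rfl <;> rcases hj with rfl | rfl | rfl <;>
        first
          | exact lt_irrefl _ hij
          | exact lt_asymm hij ‹_›
          | (simp only [kx, ky, kz] at hk; omega)
    · have b1 := inb i hi
      obtain ⟨b2, b3, b4⟩ := outb j hj
      rw [b2] at hk; rw [b3]; omega
  · obtain ⟨b2, b3, b4⟩ := outb i hi
    by_cases hj : j = x ∨ j = y ∨ j = z
    · have b1 := inb j hj
      rw [b2] at hk; rw [b3]; omega
    · obtain ⟨b5, b6, b7⟩ := outb j hj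
      rw [b2, b5] at hk; rw [b3, b6]; exact hk

lemma lx_sw {O : Type} {Arc : O → α → α → Prop} {P : O} {g : α ≃ Fin n} {c d : α}
    (hcd : (g d).val + 1 = (g c).val)
    (hP : Lx Arc P g) (hno : ¬ Arc P d c) : Lx Arc P (sw g c d) := by
  intro u v huv
  have h := hP u v huv
  refine (sw_lt_iff g hcd ?_ ?_).2 h
  · rintro ⟨rfl, rfl⟩; exact hno huv
  · rintro ⟨rfl, rfl⟩; rw [Fin.lt_def] at h; omega

/-- number of inversions -/
noncomputable def inv [Fintype α] (g : α ≃ Fin n) : ℕ := by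
  classical
  exact (Finset.univ.filter (fun p : α × α => p.1 < p.2 ∧ g p.2 < g p.1)).card

lemma inv_sw [Fintype α] (g : α ≃ Fin n) {c d : α} (hlt : c < d)
    (hcd : (g d).val + 1 = (g c).val) : inv (sw g c d) < inv g := by
  classical
  unfold inv
  apply Finset.card_lt_card
  rw [Finset.ssubset_iff_of_subset]
  · refine ⟨(c, d), ?_, ?_⟩
    · have h : g d < g c := by rw [Fin.lt_def]; omega
      simp [hlt, h]
    · have h : ¬ (g c < g d) := by rw [Fin.lt_def]; omega
      simp [sw_left, sw_right, h]
  · intro p hp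
    simp only [Finset.mem_filter, Finset.mem_univ, true_and] at hp ⊢
    exact ⟨hp.1, sw_le g hlt hcd _ _ hp.1 hp.2⟩

lemma exists_cover {s g : α ≃ Fin n} (hs : LE' s g) (hne : s ≠ g) :
    ∃ c d : α, c < d ∧ (g d).val + 1 = (g c).val ∧ s c < s d := by
  by_contra hcon
  push Not at hcon
  apply hne
  have hmono : StrictMono (fun p : Fin n => s (g.symm p)) := by
    cases n with
    | zero => intro p; exact p.elim0
    | succ m =>
      rw [Fin.strictMono_iff_lt_succ]
      intro p
      set u := g.symm p.castSucc with hu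
      set v := g.symm p.succ with hv
      have gu : g u = p.castSucc := by simp [hu]
      have gv : g v = p.succ := by simp [hv]
      have huv : u ≠ v := by
        intro h; rw [h, gv] at gu
        have := congrArg Fin.val gu; simp at this
      rcases lt_or_gt_of_ne huv with h | h
      · by_contra hc
        have h3 : s v < s u := lt_of_le_of_ne (not_lt.1 hc) (fun h => huv (s.injective h).symm)
        have h4 := hs u v h h3
        rw [gu, gv, Fin.lt_def] at h4; simp at h4
      · have h3 := hcon v u h (by rw [gu, gv]; simp)
        exact lt_of_le_of_ne h3 (fun h => huv (s.injective h))
  have hid : (fun p : Fin n => s (g.symm p)) = id := by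
    have hsurj : Function.Surjective (fun p : Fin n => s (g.symm p)) :=
      s.surjective.comp g.symm.surjective
    have := Subsingleton.elim (hmono.orderIsoOfSurjective _ hsurj) (OrderIso.refl (Fin n))
    funext p
    have h := congrArg (fun e => e p) this
    simpa using h
  ext u
  have := congrFun hid (g u)
  simp at this
  rw [this]

section main
set_option maxHeartbeats 1000000 in
theorem step_down [Fintype α] {O : Type} (Arc : O → α → α → Prop)
  (hU : ∀ (P Q : O) (g : α ≃ Fin n), Lx Arc P g → Lx Arc Q g → P = Q)
  (hF : ∀ (P : O) (g : α ≃ Fin n) (c d : α), Lx Arc P g → c < d →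
    (g d).val + 1 = (g c).val → Arc P d c →
    (∃ (Q : O) (k : α ≃ Fin n), Lx Arc Q k ∧ LE' k (sw g c d)) →
    ∃ Q : O, Lx Arc Q (sw g c d) ∧ ∀ u v, Arc Q u v → (u = c ∧ v = d) ∨ Arc P u v ∨
      Arc P (Equiv.swap c d u) (Equiv.swap c d v))
  (hK : ∀ (P : O) (g : α ≃ Fin n) (x y z : α), Lx Arc P g → x < y → y < z →
    g z < g y → g y < g x →
    (∃ (Q : O) (k : α ≃ Fin n), Lx Arc Q k ∧ k x < k y) →
    (∃ (Q : O) (k : α ≃ Fin n), Lx Arc Q k ∧ k y < k z) → ¬ Arc P z x)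
  (N : ℕ) : ∀ (t : α ≃ Fin n), inv t < N → ∀ (P' P : O) (c d : α) (s : α ≃ Fin n),
    c < d → (t d).val + 1 = (t c).val → Lx Arc P' t → Lx Arc P' (sw t c d) →
    Lx Arc P s → LE' s t → ∃ s1, Lx Arc P s1 ∧ LE' s1 (sw t c d) := by
  induction N with
  | zero => intro t h; omega
  | succ N ih =>
    intro t hN P' P c d s hcd hadj hP't hP'1 hPs hst
    by_cases hscd : s c < s d
    · exact ⟨s, hPs, le_sw hcd hadj hst hscd⟩
    by_cases hse : s = t
    · subst hse
      have := hU P P' s hPs hP't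
      subst this
      exact ⟨_, hP'1, fun _ _ _ h => h⟩
    obtain ⟨e, f, hef, hadj', hsef⟩ := exists_cover hst hse
    have hsk : LE' s (sw t e f) := le_sw hef hadj' hst hsef
    have hinvk := inv_sw t hef hadj'
    obtain ⟨Q, hQ, hQarc⟩ : ∃ Q : O, Lx Arc Q (sw t e f) ∧ ∀ u v, Arc Q u v →
        (u = e ∧ v = f) ∨ Arc P' u v ∨ Arc P' (Equiv.swap e f u) (Equiv.swap e f v) := by
      by_cases harc : Arc P' f e
      · exact hF P' t e f hP't hef hadj' harc ⟨P, s, hPs, hsk⟩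
      · exact ⟨P', lx_sw hadj' hP't harc, fun u v h => Or.inr (Or.inl h)⟩
    have hnodc : ¬ Arc P' d c := by
      intro h; have := hP'1 d c h
      rw [sw_left, sw_right, Fin.lt_def] at this; omega
    have hne1 : ¬ (e = c) := by
      rintro rfl
      have : f = d := t.injective (Fin.ext (by omega))
      subst this; exact hscd hsef
    have hne2 : ¬ (f = d) := by
      rintro rfl
      have : e = c := t.injective (Fin.ext (by omega))
      exact hne1 this
    by_cases hfc : f = c
    · -- `t = d c e`, with `d > c > e`
      subst hfc
      have hed : e ≠ d := (hef.trans hcd).ne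
      have hnozx : ¬ Arc P' d e := by
        refine hK P' t e f d hP't hef hcd (by rw [Fin.lt_def]; omega) (by rw [Fin.lt_def]; omega)
          ⟨P, s, hPs, hsef⟩ ⟨P', _, hP'1, ?_⟩
        rw [sw_left, sw_right, Fin.lt_def]; omega
      have hs1 : Equiv.swap e f d = d := Equiv.swap_apply_of_ne_of_ne hed.symm (Ne.symm hne2)
      have hQ1 : ¬ Arc Q d e := by
        intro h; rcases hQarc _ _ h with h | h | h
        · exact hed h.1.symm
        · exact hnozx h
        · rw [hs1, Equiv.swap_apply_left] at h; exact hnodc h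
      have hQ2 : ¬ Arc Q d f := by
        intro h; rcases hQarc _ _ h with h | h | h
        · exact hed h.1.symm
        · exact hnodc h
        · rw [hs1, Equiv.swap_apply_right] at h; exact hnozx h
      have k1 : sw t e f e = t f := sw_left ..
      have k2 : sw t e f f = t e := sw_right ..
      have k3 : sw t e f d = t d := sw_other _ hed.symm (Ne.symm hne2)
      have a1 : (sw t e f d).val + 1 = (sw t e f e).val := by rw [k1, k3]; omega
      have L1 := lx_sw a1 hQ hQ1
      have i1 := inv_sw (sw t e f) (hef.trans hcd) a1
      obtain ⟨s1, hs1, hle1⟩ := ih (sw t e f) (by omega) Q P e d s (hef.trans hcd) a1 hQ L1 hPs hsk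
      have m1 : sw (sw t e f) e d e = t d := by rw [sw_left, k3]
      have m2 : sw (sw t e f) e d d = t f := by rw [sw_right, k1]
      have m3 : sw (sw t e f) e d f = t e := by rw [sw_other _ hef.ne' hne2, k2]
      have a2 : (sw (sw t e f) e d d).val + 1 = (sw (sw t e f) e d f).val := by rw [m2, m3]; omega
      have L2 := lx_sw a2 L1 hQ2
      obtain ⟨s2, hs2, hle2⟩ := ih _ (by omega) Q P f d s1 hcd a2 L1 L2 hs1 hle1
      refine ⟨s2, hs2, hle2.trans ?_⟩
      refine hex_le hef hcd hadj hadj' (fun u h1 h2 h3 => ⟨?_, sw_other _ h2 h3⟩) ?_ ?_ ?_ ?_ ?_ ?_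
      · rw [sw_other _ h2 h3, sw_other _ h1 h3, sw_other _ h1 h2]
      · rw [sw_other _ hef.ne hed, m1]
      · rw [sw_left, m2]
      · rw [sw_right, m3]
      · rw [sw_other _ hef.ne hed]; omega
      · rw [sw_left]; omega
      · rw [sw_right]; omega
    by_cases hed : e = d
    · -- `t = f d c`, with `f > d > c`
      subst hed
      have hcf : c ≠ f := (hcd.trans hef).ne
      have hnozx : ¬ Arc P' f c := by
        refine hK P' t c e f hP't hcd hef (by rw [Fin.lt_def]; omega) (by rw [Fin.lt_def]; omega)
          ⟨P', _, hP'1, ?_⟩ ⟨P, s, hPs, hsef⟩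
        rw [sw_left, sw_right, Fin.lt_def]; omega
      have hs1 : Equiv.swap e f c = c := Equiv.swap_apply_of_ne_of_ne hcd.ne hcf
      have hQ1 : ¬ Arc Q f c := by
        intro h; rcases hQarc _ _ h with h | h | h
        · exact hcf h.2
        · exact hnozx h
        · rw [hs1, Equiv.swap_apply_right] at h; exact hnodc h
      have hQ2 : ¬ Arc Q e c := by
        intro h; rcases hQarc _ _ h with h | h | h
        · exact hcf h.2
        · exact hnodc h
        · rw [hs1, Equiv.swap_apply_left] at h; exact hnozx h
      have k1 : sw t e f e = t f := sw_left ..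
      have k2 : sw t e f f = t e := sw_right ..
      have k3 : sw t e f c = t c := sw_other _ hcd.ne hcf
      have a1 : (sw t e f f).val + 1 = (sw t e f c).val := by rw [k2, k3]; omega
      have L1 := lx_sw a1 hQ hQ1
      have i1 := inv_sw (sw t e f) (hcd.trans hef) a1
      obtain ⟨s1, hs1, hle1⟩ := ih (sw t e f) (by omega) Q P c f s (hcd.trans hef) a1 hQ L1 hPs hsk
      have m1 : sw (sw t e f) c f c = t e := by rw [sw_left, k2]
      have m2 : sw (sw t e f) c f f = t c := by rw [sw_right, k3]
      have m3 : sw (sw t e f) c f e = t f := by rw [sw_other _ hcd.ne' hef.ne, k1]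
      have a2 : (sw (sw t e f) c f e).val + 1 = (sw (sw t e f) c f c).val := by rw [m1, m3]; omega
      have L2 := lx_sw a2 L1 hQ2
      obtain ⟨s2, hs2, hle2⟩ := ih _ (by omega) Q P c e s1 hcd a2 L1 L2 hs1 hle1
      refine ⟨s2, hs2, hle2.trans ?_⟩
      refine hex_le hcd hef hadj' hadj (fun u h1 h2 h3 => ⟨?_, sw_other _ h1 h2⟩) ?_ ?_ ?_ ?_ ?_ ?_
      · rw [sw_other _ h1 h2, sw_other _ h1 h3, sw_other _ h2 h3]
      · rw [sw_left, m3]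
      · rw [sw_right, m1]
      · rw [sw_other _ hcf.symm hef.ne', m2]
      · rw [sw_left]; omega
      · rw [sw_right]; omega
      · rw [sw_other _ hcf.symm hef.ne']; omega
    · -- disjoint case
      have k1 : sw t e f c = t c := sw_other _ (Ne.symm hne1) (Ne.symm hfc)
      have k2 : sw t e f d = t d := sw_other _ (Ne.symm hed) (Ne.symm hne2)
      have hQ1 : ¬ Arc Q d c := by
        intro h; rcases hQarc _ _ h with h | h | h
        · exact hed h.1.symm
        · exact hnodc h
        · rw [Equiv.swap_apply_of_ne_of_ne (Ne.symm hed) (Ne.symm hne2),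
            Equiv.swap_apply_of_ne_of_ne (Ne.symm hne1) (Ne.symm hfc)] at h
          exact hnodc h
      have a1 : (sw t e f d).val + 1 = (sw t e f c).val := by rw [k1, k2]; exact hadj
      obtain ⟨s1, hs1, hle1⟩ := ih (sw t e f) (by omega) Q P c d s hcd a1 hQ
        (lx_sw a1 hQ hQ1) hPs hsk
      refine ⟨s1, hs1, hle1.trans ?_⟩
      have hcomm : sw (sw t e f) c d = sw (sw t c d) e f := by
        ext u
        by_cases u1 : u = e
        · subst u1
          rw [sw_left, sw_other _ hne1 hed, sw_left, sw_other _ hfc hne2]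
        by_cases u2 : u = f
        · subst u2
          rw [sw_right, sw_other _ hfc hne2, sw_right, sw_other _ hne1 hed]
        rw [sw_other _ u1 u2]
        by_cases u3 : u = c
        · subst u3; rw [sw_left, sw_left, k2]
        by_cases u4 : u = d
        · subst u4; rw [sw_right, sw_right, k1]
        rw [sw_other _ u3 u4, sw_other _ u1 u2, sw_other _ u3 u4]
      rw [hcomm]
      apply sw_le _ hef
      rw [sw_other _ hne1 hed, sw_other _ hfc hne2]; exact hadj'

theorem class_down [Fintype α] {O : Type} (Arc : O → α → α → Prop)
  (hU : ∀ (P Q : O) (g : α ≃ Fin n), Lx Arc P g → Lx Arc Q g → P = Q)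
  (hF : ∀ (P : O) (g : α ≃ Fin n) (c d : α), Lx Arc P g → c < d →
    (g d).val + 1 = (g c).val → Arc P d c →
    (∃ (Q : O) (k : α ≃ Fin n), Lx Arc Q k ∧ LE' k (sw g c d)) →
    ∃ Q : O, Lx Arc Q (sw g c d) ∧ ∀ u v, Arc Q u v → (u = c ∧ v = d) ∨ Arc P u v ∨
      Arc P (Equiv.swap c d u) (Equiv.swap c d v))
  (hK : ∀ (P : O) (g : α ≃ Fin n) (x y z : α), Lx Arc P g → x < y → y < z →
    g z < g y → g y < g x →
    (∃ (Q : O) (k : α ≃ Fin n), Lx Arc Q k ∧ k x < k y) →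
    (∃ (Q : O) (k : α ≃ Fin n), Lx Arc Q k ∧ k y < k z) → ¬ Arc P z x)
  (N : ℕ) : ∀ (t : α ≃ Fin n), inv t < N → ∀ (P' P : O) (r s : α ≃ Fin n),
    Lx Arc P' t → Lx Arc P' r → LE' r t → Lx Arc P s → LE' s t →
    ∃ p, Lx Arc P p ∧ LE' p r := by
  induction N with
  | zero => intro t h; omega
  | succ N ih =>
    intro t hN P' P r s ht hr hrt hs hst
    by_cases hre : r = t
    · subst hre; exact ⟨s, hs, hst⟩
    obtain ⟨c, d, hcd, hadj, hrcd⟩ := exists_cover hrt hre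
    have hno : ¬ Arc P' d c := fun h => absurd (hr _ _ h) (not_lt.2 hrcd.le)
    have L1 := lx_sw hadj ht hno
    obtain ⟨s1, hs1, hle1⟩ := step_down Arc hU hF hK (inv t + 1) t (by omega) P' P c d s
      hcd hadj ht L1 hs hst
    have := inv_sw t hcd hadj
    exact ih _ (by omega) P' P r s1 L1 hr (le_sw hcd hadj hrt hrcd) hs1 hle1

end main

end PDComb
namespace PDNet

open PipeDream

variable {n : ℕ}

/-- crossing at time `d` exchanging the positions `p` and `p + 1`; the box `(r, c)` acts at time
`c + n - r` on the positions `r + c` and `r + c + 1` -/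
def X (P : PipeDream n) (d p : ℕ) : Bool :=
  decide (n ≤ d + p ∧ d ≤ n + p ∧ (d + p + n) % 2 = 0) &&
    P.cross ((p + n - d) / 2) ((p + d - n) / 2)

/-- position change at time `d` -/
def f (P : PipeDream n) (d p : ℕ) : ℕ :=
  if X P d p = true then p + 1 else if p ≠ 0 ∧ X P d (p - 1) = true then p - 1 else p

/-- label at time `d` and position `p` -/
def lab (P : PipeDream n) : ℕ → ℕ → ℕ
  | 0, p => p
  | d + 1, p => lab P d (f P d p)

/-- position at time `d` of pipe `k` -/
def pos (P : PipeDream n) : ℕ → ℕ → ℕ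
  | 0, k => k
  | d + 1, k => f P d (pos P d k)

lemma X_box (P : PipeDream n) {r c d : ℕ} (hd : d + r = c + n) : X P d (r + c) = P.cross r c := by
  unfold X
  have h1 : (r + c + n - d) / 2 = r := by omega
  have h2 : (r + c + d - n) / 2 = c := by omega
  rw [h1, h2]
  have : (n ≤ d + (r + c) ∧ d ≤ n + (r + c) ∧ (d + (r + c) + n) % 2 = 0) := by omega
  simp [this]

lemma X_spec (P : PipeDream n) {d p : ℕ} (h : X P d p = true) :
    ∃ r c, p = r + c ∧ d + r = c + n ∧ r + c + 2 ≤ n ∧ P.cross r c = true := by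
  unfold X at h
  simp only [Bool.and_eq_true, decide_eq_true_eq] at h
  obtain ⟨⟨h1, h2, h3⟩, h4⟩ := h
  exact ⟨_, _, by omega, by omega, P.inShape _ _ h4, h4⟩

lemma X_lt (P : PipeDream n) {d p : ℕ} (h : X P d p = true) :
    p + 2 ≤ n ∧ n ≤ d + p ∧ d ≤ n + p ∧ (d + p + n) % 2 = 0 := by
  obtain ⟨r, c, h1, h2, h3, _⟩ := X_spec P h
  omega

lemma X_par (P : PipeDream n) {d p q : ℕ} (h : (d + p + n) % 2 = 0) (hq : (q + p) % 2 = 1) :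
    X P d q = false := by
  by_contra hc
  have := X_lt P (by simpa using hc : X P d q = true)
  omega

lemma f_cases (P : PipeDream n) (d p : ℕ) :
    (X P d p = true ∧ f P d p = p + 1) ∨
    (∃ q, p = q + 1 ∧ X P d q = true ∧ f P d p = q) ∨
    (X P d p = false ∧ (∀ q, p = q + 1 → X P d q = false) ∧ f P d p = p) := by
  unfold f
  by_cases h : X P d p = true
  · left; simp [h]
  · right
    simp only [h]
    by_cases h' : p ≠ 0 ∧ X P d (p - 1) = true
    · left; exact ⟨p - 1, by omega, h'.2, by simp [h']⟩
    · right
      refine ⟨by simpa using h, ?_, by simp [h']⟩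
      rintro q rfl
      by_contra hc
      exact h' ⟨by omega, by simpa using hc⟩

lemma f_of_X (P : PipeDream n) {d p : ℕ} (h : X P d p = true) : f P d p = p + 1 ∧ f P d (p + 1) = p := by
  have h1 := (X_lt P h).2.2.2
  refine ⟨by simp [f, h], ?_⟩
  have := X_par P (q := p + 1) h1 (by omega)
  simp [f, this, h]

lemma f_of_not (P : PipeDream n) {d p : ℕ} (hp : (d + p + n) % 2 = 0) (h : X P d p = false) :
    f P d p = p ∧ f P d (p + 1) = p + 1 := by
  have h2 := X_par P (q := p + 1) hp (by omega)
  refine ⟨?_, by simp [f, h, h2]⟩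
  rcases f_cases P d p with h' | ⟨q, rfl, h3, _⟩ | h'
  · simp [h] at h'
  · have := X_lt P h3; omega
  · exact h'.2.2

lemma f_f (P : PipeDream n) (d p : ℕ) : f P d (f P d p) = p := by
  rcases f_cases P d p with ⟨h, h'⟩ | ⟨q, rfl, h, h'⟩ | ⟨_, _, h⟩
  · rw [h', (f_of_X P h).2]
  · rw [h', (f_of_X P h).1]
  · rw [h, h]

lemma f_le (P : PipeDream n) (d p : ℕ) : f P d p ≤ p + 1 ∧ p ≤ f P d p + 1 := by
  rcases f_cases P d p with ⟨h, h'⟩ | ⟨q, rfl, h, h'⟩ | ⟨_, _, h⟩ <;> omega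

lemma f_lt (P : PipeDream n) {d p : ℕ} (hp : p < n) : f P d p < n := by
  rcases f_cases P d p with ⟨h, h'⟩ | ⟨q, rfl, h, h'⟩ | ⟨_, _, h⟩
  · have := X_lt P h; omega
  · omega
  · omega

lemma lab_pos (P : PipeDream n) (d k : ℕ) : lab P d (pos P d k) = k := by
  induction d with
  | zero => rfl
  | succ d ih => simp only [lab, pos, f_f, ih]

lemma pos_lab (P : PipeDream n) (d p : ℕ) : pos P d (lab P d p) = p := by
  induction d generalizing p with
  | zero => rfl
  | succ d ih => simp only [lab, pos, ih, f_f]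

lemma lab_inj (P : PipeDream n) {d p q : ℕ} (h : lab P d p = lab P d q) : p = q := by
  rw [← pos_lab P d p, h, pos_lab]

lemma pos_inj (P : PipeDream n) {d p q : ℕ} (h : pos P d p = pos P d q) : p = q := by
  rw [← lab_pos P d p, h, lab_pos]

lemma lab_lt (P : PipeDream n) {d p : ℕ} (hp : p < n) : lab P d p < n := by
  induction d generalizing p with
  | zero => exact hp
  | succ d ih => exact ih (f_lt P hp)

lemma pos_lt (P : PipeDream n) {d p : ℕ} (hp : p < n) : pos P d p < n := by
  induction d with
  | zero => exact hp
  | succ d ih => exact f_lt P ih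

lemma lab_early (P : PipeDream n) {d p : ℕ} (h : d + p ≤ n) : lab P d p = p := by
  induction d with
  | zero => rfl
  | succ d ih =>
    have : f P d p = p := by
      rcases f_cases P d p with ⟨h, h'⟩ | ⟨q, rfl, h, h'⟩ | ⟨_, _, h⟩
      · have := X_lt P h; omega
      · have := X_lt P h; omega
      · exact h
    simp only [lab, this]; exact ih (by omega)

lemma lab_late (P : PipeDream n) {d p e : ℕ} (h : n + p + 1 ≤ d) : lab P (d + e) p = lab P d p := by
  induction e with
  | zero => rfl
  | succ e ih =>
    have : f P (d + e) p = p := by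
      rcases f_cases P (d + e) p with ⟨h, h'⟩ | ⟨q, rfl, h, h'⟩ | ⟨_, _, h⟩
      · have := X_lt P h; omega
      · have := X_lt P h; omega
      · exact h
    rw [← add_assoc]
    simp only [lab, this]; exact ih

lemma west_zero (P : PipeDream n) (r : ℕ) : P.west r 0 = r := by
  unfold west; rw [pipes]; simp

lemma west_succ (P : PipeDream n) (r c : ℕ) :
    P.west r (c + 1) = if P.cross r c then P.west r c else P.south r c := by
  unfold west south; rw [pipes]; simp

lemma south_eq (P : PipeDream n) {r c : ℕ} (h : r + c + 2 ≤ n) :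
    P.south r c = if P.cross (r + 1) c then P.south (r + 1) c else P.west (r + 1) c := by
  unfold west south; rw [pipes]; simp [h]

lemma lab_box (P : PipeDream n) : ∀ (m r c d : ℕ), (n - r) + c ≤ m → d + r = c + n →
    (r + c + 1 ≤ n → P.west r c = lab P d (r + c)) ∧
    (r + c + 2 ≤ n → P.south r c = lab P d (r + c + 1)) := by
  intro m
  induction m with
  | zero =>
    intro r c d h1 h2
    exact ⟨fun h => by omega, fun h => by omega⟩
  | succ m ih =>
    intro r c d h1 h2
    constructor
    · intro h
      cases c with
      | zero => rw [west_zero]; exact (lab_early P (by omega)).symm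
      | succ c =>
        obtain ⟨d, rfl⟩ : ∃ d', d = d' + 1 := ⟨d - 1, by omega⟩
        have ihc := ih r c d (by omega) (by omega)
        have hb := X_box P (r := r) (c := c) (d := d) (by omega)
        rw [west_succ]
        by_cases hx : P.cross r c = true
        · rw [if_pos hx, ihc.1 (by omega)]
          rw [hx] at hb
          show _ = lab P d (f P d (r + c + 1))
          rw [(f_of_X P hb).2]
        · rw [if_neg hx, ihc.2 (by omega)]
          rw [Bool.not_eq_true] at hx
          rw [hx] at hb
          show _ = lab P d (f P d (r + c + 1))
          rw [(f_of_not P (by omega) hb).2]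
    · intro h
      obtain ⟨d, rfl⟩ : ∃ d', d = d' + 1 := ⟨d - 1, by omega⟩
      have ihc := ih (r + 1) c d (by omega) (by omega)
      have hb := X_box P (r := r + 1) (c := c) (d := d) (by omega)
      have e : r + c + 1 = r + 1 + c := by omega
      rw [south_eq P h]
      by_cases hx : P.cross (r + 1) c = true
      · rw [if_pos hx, ihc.2 (P.inShape _ _ hx)]
        rw [hx] at hb
        show _ = lab P d (f P d (r + c + 1))
        rw [e, (f_of_X P hb).1]
      · rw [if_neg hx, ihc.1 (by omega)]
        rw [Bool.not_eq_true] at hx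
        rw [hx] at hb
        show _ = lab P d (f P d (r + c + 1))
        rw [e, (f_of_not P (by omega) hb).1]

lemma west_lab (P : PipeDream n) {r c d : ℕ} (hd : d + r = c + n) (h : r + c + 1 ≤ n) :
    P.west r c = lab P d (r + c) := (lab_box P _ r c d le_rfl hd).1 h

lemma south_lab (P : PipeDream n) {r c d : ℕ} (hd : d + r = c + n) (h : r + c + 2 ≤ n) :
    P.south r c = lab P d (r + c + 1) := (lab_box P _ r c d le_rfl hd).2 h

lemma lab_succ_X (P : PipeDream n) {d p : ℕ} (h : X P d p = true) :
    lab P (d + 1) p = lab P d (p + 1) ∧ lab P (d + 1) (p + 1) = lab P d p := by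
  have := f_of_X P h
  simp [lab, this]

lemma lab_succ_not (P : PipeDream n) {d p : ℕ} (hp : (d + p + n) % 2 = 0) (h : X P d p = false) :
    lab P (d + 1) p = lab P d p ∧ lab P (d + 1) (p + 1) = lab P d (p + 1) := by
  have := f_of_not P hp h
  simp [lab, this]

lemma exit_lab (P : PipeDream n) {c : ℕ} (h : c < n) : P.exitPipe c = lab P (2 * n) c := by
  have e : 2 * n = (c + n + 1) + (n - c - 1) := by omega
  rw [e, lab_late P (by omega)]
  unfold exitPipe
  have hb := X_box P (r := 0) (c := c) (d := c + n) (by omega)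
  have hw := west_lab P (r := 0) (c := c) (d := c + n) (by omega) (by omega)
  simp only [Nat.zero_add] at hb hw
  by_cases hx : P.cross 0 c = true
  · have hs := south_lab P (r := 0) (c := c) (d := c + n) (by omega) (P.inShape _ _ hx)
    simp only [Nat.zero_add] at hs
    rw [if_pos hx, hs, (lab_succ_X P (by rw [hb, hx])).1]
  · rw [if_neg hx, hw, (lab_succ_not P (by omega) (by rw [hb]; simpa using hx)).1]

/-- change of relative order is a crossing -/
lemma order_change (P : PipeDream n) {d i j : ℕ} (h : pos P d i < pos P d j)
    (h' : pos P (d + 1) j < pos P (d + 1) i) :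
    X P d (pos P d i) = true ∧ pos P d j = pos P d i + 1 := by
  simp only [pos] at h'
  have h1 := f_cases P d (pos P d i)
  have h2 := f_cases P d (pos P d j)
  rcases h1 with ⟨a, b⟩ | ⟨q, a, b, b'⟩ | ⟨a, b, b'⟩ <;>
  rcases h2 with ⟨a2, b2⟩ | ⟨q2, a2, b2, b2'⟩ | ⟨a2, b2, b2'⟩ <;> try omega
  · refine ⟨a, ?_⟩
    have := X_lt P a; have := X_lt P b2; omega

lemma exists_change {Q : ℕ → Prop} {a b : ℕ} (hab : a ≤ b) (ha : ¬ Q a) (hb : Q b) :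
    ∃ m, a ≤ m ∧ m < b ∧ ¬ Q m ∧ Q (m + 1) := by
  induction b, hab using Nat.le_induction with
  | base => exact absurd hb ha
  | succ b hab ih =>
    by_cases h : Q b
    · obtain ⟨m, h1, h2, h3⟩ := ih h
      exact ⟨m, h1, by omega, h3⟩
    · exact ⟨b, hab, by omega, h, hb⟩

lemma exists_crossing (P : PipeDream n) {i j a b : ℕ} (hab : a ≤ b)
    (ha : pos P a i < pos P a j) (hb : pos P b j < pos P b i) :
    ∃ m, a ≤ m ∧ m < b ∧ X P m (pos P m i) = true ∧ pos P m j = pos P m i + 1 := by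
  obtain ⟨m, h1, h2, h3, h4⟩ := exists_change (Q := fun d => pos P d j < pos P d i) hab
    (not_lt.2 ha.le) hb
  have hne : pos P m i ≠ pos P m j := by
    intro h; have := pos_inj P h; subst this; omega
  have := order_change P (lt_of_le_of_ne (not_lt.1 h3) hne) h4
  exact ⟨m, h1, h2, this⟩

/-- every crossing puts the smaller pipe on the west side -/
def Red (P : PipeDream n) : Prop := ∀ d p, X P d p = true → lab P d p < lab P d (p + 1)

lemma Red.order {P : PipeDream n} (hP : Red P) {i j a b : ℕ} (hab : a ≤ b)
    (ha : pos P a i < pos P a j) (hb : pos P b j < pos P b i) : i < j := by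
  obtain ⟨m, _, _, h1, h2⟩ := exists_crossing P hab ha hb
  have := hP _ _ h1
  rwa [← h2, lab_pos, lab_pos] at this

/-- order of uncrossed pipes at earlier times -/
lemma Red.before {P : PipeDream n} (hP : Red P) {i j a b : ℕ} (hab : a ≤ b) (hij : i < j)
    (hb : pos P b i < pos P b j) : pos P a i < pos P a j := by
  by_contra hc
  have hne : pos P a j ≠ pos P a i := by
    intro h; have := pos_inj P h; omega
  have := hP.order hab (lt_of_le_of_ne (not_lt.1 hc) hne) hb
  omega

/-- order of crossed pipes at later times -/
lemma Red.after {P : PipeDream n} (hP : Red P) {i j a b : ℕ} (hab : a ≤ b) (hij : i < j)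
    (ha : pos P a j < pos P a i) : pos P b j < pos P b i := by
  by_contra hc
  have hne : pos P b j ≠ pos P b i := by
    intro h; have := pos_inj P h; omega
  have := hP.order hab ha (lt_of_le_of_ne (not_lt.1 hc) (Ne.symm hne))
  omega

lemma red_of_reduced (P : PipeDream n) (h : P.Reduced) : Red P := by
  intro d p hx
  by_contra hc
  have hlt : lab P d (p + 1) < lab P d p := by
    refine lt_of_le_of_ne (not_lt.1 hc) ?_
    intro h; have := lab_inj P h; omega
  obtain ⟨r, c, hp, hd, hs, hcr⟩ := X_spec P hx
  set i := lab P d p with hi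
  set j := lab P d (p + 1) with hj
  have pi : pos P d i = p := pos_lab ..
  have pj : pos P d j = p + 1 := pos_lab ..
  obtain ⟨m, _, hm, h1, h2⟩ := exists_crossing P (i := j) (j := i) (a := 0) (b := d) (by omega)
    hlt (by omega)
  obtain ⟨r', c', hp', hd', hs', hcr'⟩ := X_spec P h1
  refine h r c r' c' hcr hcr' ?_ (Or.inr ⟨?_, ?_⟩)
  · intro h; simp only [Prod.mk.injEq] at h; omega
  · rw [west_lab P hd (by omega), south_lab P hd' hs', ← hp, ← hp', ← h2, lab_pos]
  · rw [south_lab P hd hs, west_lab P hd' (by omega), ← hp, ← hp', lab_pos]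

lemma reduced_of_red (P : PipeDream n) (hP : Red P) : P.Reduced := by
  have key : ∀ d p d' p', X P d p = true → X P d' p' = true → d < d' →
      lab P d p = lab P d' p' → lab P d (p + 1) = lab P d' (p' + 1) → False := by
    intro d p d' p' h1 h2 h3 h4 h5
    have := hP.after (i := lab P d p) (j := lab P d (p + 1)) (a := d + 1) (b := d') (by omega)
      (hP d p h1) (by
        rw [← (lab_succ_X P h1).1, ← (lab_succ_X P h1).2, pos_lab, pos_lab]; omega)
    rw [h4, h5, pos_lab, pos_lab] at this
    omega
  intro r c r' c' h1 h2 hne hh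
  have s1 := P.inShape _ _ h1
  have s2 := P.inShape _ _ h2
  obtain ⟨d, hd⟩ : ∃ d, d + r = c + n := ⟨c + n - r, by omega⟩
  obtain ⟨d', hd'⟩ : ∃ d, d + r' = c' + n := ⟨c' + n - r', by omega⟩
  rw [west_lab P hd (by omega), west_lab P hd' (by omega), south_lab P hd s1,
    south_lab P hd' s2] at hh
  have x1 := X_box P hd
  have x2 := X_box P hd'
  rw [h1] at x1
  rw [h2] at x2
  have l1 := hP _ _ x1
  have l2 := hP _ _ x2
  rcases hh with ⟨a, b⟩ | ⟨a, b⟩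
  · rcases lt_trichotomy d d' with h | h | h
    · exact key _ _ _ _ x1 x2 h a b
    · subst h
      have := lab_inj P a
      apply hne; simp only [Prod.mk.injEq]; omega
    · exact key _ _ _ _ x2 x1 h a.symm b.symm
  · omega

end PDNet
namespace PDNet

open PipeDream

variable {n : ℕ}

lemma pos_of_lab (P : PipeDream n) {d p k : ℕ} (h : k = lab P d p) : pos P d k = p := by
  rw [h, pos_lab]

lemma V_all {P : PipeDream n} (hP : Red P) : ∀ m r c d, n - (r + c) ≤ m → d + r = c + n →
    r + c + 1 ≤ n →
    (∀ w, w < n → P.cross r c = false → r + c < pos P d w → P.Path (lab P d (r + c)) w) ∧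
    (∀ w, w < n → lab P (d + 1) (r + c) < w → r + c < pos P (d + 1) w →
      P.Path (lab P (d + 1) (r + c)) w) ∧
    (∀ w, w < n → w < lab P d (r + c) → r + c < pos P d w → P.Path (lab P d (r + c)) w) := by
  intro m
  induction m with
  | zero => intro r c d h1 h2 h3; omega
  | succ m ih =>
    intro r c d h1 h2 h3
    have hV : ∀ w, w < n → P.cross r c = false → r + c < pos P d w →
        P.Path (lab P d (r + c)) w := by
      intro w hw hx hpw
      have hlt := pos_lt P (d := d) hw
      have hs : r + c + 2 ≤ n := by omega
      obtain ⟨e, rfl⟩ : ∃ e, d = e + 1 := ⟨d - 1, by omega⟩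
      have harc : P.Arc (lab P (e + 1) (r + c)) (lab P (e + 1) (r + c + 1)) :=
        ⟨r, c, hs, hx, west_lab P h2 h3, south_lab P h2 hs⟩
      refine Relation.ReflTransGen.head harc ?_
      have hb := X_box P h2
      rw [hx] at hb
      have hl := (lab_succ_not P (by omega) hb).2
      by_cases hvw : lab P (e + 1) (r + c + 1) = w
      · rw [hvw]
      have hne : pos P (e + 1) w ≠ r + c + 1 := by
        intro h; rw [← h, lab_pos] at hvw; exact hvw rfl
      have e1 : r + 1 + c = r + c + 1 := by omega
      rcases lt_or_gt_of_ne hvw with h | h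
      · have := (ih (r + 1) c e (by omega) (by omega) (by omega)).2.1 w hw
        rw [e1] at this
        exact this h (by omega)
      · have := (ih r (c + 1) (e + 2) (by omega) (by omega) (by omega)).2.2 w hw
        rw [← add_assoc, hl] at this
        refine this h ?_
        have h5 := hP.after (a := e + 1) (b := e + 1 + 1) (by omega) h
          (by rw [pos_lab]; omega)
        rw [pos_of_lab P hl.symm] at h5
        exact h5
    refine ⟨hV, ?_, ?_⟩
    · intro w hw hlt hpw
      have hbf := hP.before (a := d) (b := d + 1) (by omega) hlt (by rw [pos_lab]; exact hpw)
      have hb := X_box P h2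
      by_cases hx : P.cross r c = true
      · have hs := P.inShape _ _ hx
        rw [hx] at hb
        have hl := (lab_succ_X P hb).1
        rw [hl] at hlt hbf ⊢
        obtain ⟨e, rfl⟩ : ∃ e, d = e + 1 := ⟨d - 1, by omega⟩
        have e1 : r + 1 + c = r + c + 1 := by omega
        have := (ih (r + 1) c e (by omega) (by omega) (by omega)).2.1 w hw
        rw [e1] at this
        rw [pos_lab] at hbf
        exact this hlt hbf
      · have hx' : P.cross r c = false := by simpa using hx
        rw [hx'] at hb
        have hl := (lab_succ_not P (by omega) hb).1
        rw [hl] at hbf ⊢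
        rw [pos_lab] at hbf
        exact hV w hw hx' hbf
    · intro w hw hlt hpw
      by_cases hx : P.cross r c = true
      · have hs := P.inShape _ _ hx
        have hb := X_box P h2
        rw [hx] at hb
        have hl := (lab_succ_X P hb).2
        have haf := hP.after (a := d) (b := d + 1) (by omega) hlt (by rw [pos_lab]; exact hpw)
        rw [← hl] at hlt haf ⊢
        rw [pos_lab] at haf
        exact (ih r (c + 1) (d + 1) (by omega) (by omega) (by omega)).2.2 w hw hlt haf
      · exact hV w hw (by simpa using hx) hpw

/-- a pipe turning west-to-north has a path to every pipe southeast of it at this moment -/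
lemma V {P : PipeDream n} (hP : Red P) {r c d w : ℕ} (hd : d + r = c + n) (hs : r + c + 1 ≤ n)
    (hx : P.cross r c = false) (hw : w < n) (h : r + c < pos P d w) :
    P.Path (lab P d (r + c)) w :=
  (V_all hP _ r c d le_rfl hd hs).1 w hw hx h

/-- tracing back a northwards travelling pipe to its previous west-to-north turn -/
lemma trace_back (P : PipeDream n) : ∀ m r c d, n - (r + c) ≤ m → d + r = c + n → r + c + 2 ≤ n →
    ∃ r' d', d' < d ∧ d' + r' = c + n ∧ r' + c + 1 ≤ n ∧ P.cross r' c = false ∧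
      lab P d' (r' + c) = lab P d (r + c + 1) := by
  intro m
  induction m with
  | zero => intro r c d h1 h2 h3; omega
  | succ m ih =>
    intro r c d h1 h2 h3
    obtain ⟨e, rfl⟩ : ∃ e, d = e + 1 := ⟨d - 1, by omega⟩
    have e1 : r + 1 + c = r + c + 1 := by omega
    have hb := X_box P (r := r + 1) (c := c) (d := e) (by omega)
    by_cases hx : P.cross (r + 1) c = true
    · have hs := P.inShape _ _ hx
      obtain ⟨r', d', g1, g2, g3, g4, g5⟩ := ih (r + 1) c e (by omega) (by omega) (by omega)
      rw [hx] at hb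
      refine ⟨r', d', by omega, g2, g3, g4, ?_⟩
      rw [g5, ← (lab_succ_X P hb).1, e1]
    · have hx' : P.cross (r + 1) c = false := by simpa using hx
      rw [hx'] at hb
      refine ⟨r + 1, e, by omega, by omega, by omega, hx', ?_⟩
      rw [← (lab_succ_not P (by omega) hb).1, e1]

/-- tracing forward an eastwards travelling pipe to its next west-to-north turn -/
lemma trace_fwd (P : PipeDream n) : ∀ m r c d, n - (r + c) ≤ m → d + r = c + n → r + c + 1 ≤ n →
    ∃ c' d', d ≤ d' ∧ d' + r = c' + n ∧ r + c' + 1 ≤ n ∧ P.cross r c' = false ∧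
      lab P d' (r + c') = lab P d (r + c) := by
  intro m
  induction m with
  | zero => intro r c d h1 h2 h3; omega
  | succ m ih =>
    intro r c d h1 h2 h3
    have hb := X_box P h2
    by_cases hx : P.cross r c = true
    · have hs := P.inShape _ _ hx
      obtain ⟨r', d', g1, g2, g3, g4, g5⟩ := ih r (c + 1) (d + 1) (by omega) (by omega) (by omega)
      rw [hx] at hb
      refine ⟨r', d', by omega, g2, g3, g4, ?_⟩
      rw [g5, ← (lab_succ_X P hb).2, add_assoc]
    · exact ⟨c, d, le_rfl, h2, h3, by simpa using hx, rfl⟩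

/-- a pipe coming from the south is connected to later pipes not crossing it -/
lemma path_back {P : PipeDream n} (hP : Red P) {r c d w : ℕ} (hd : d + r = c + n)
    (hs : r + c + 2 ≤ n) (hw : w < n) (hlt : lab P d (r + c + 1) < w)
    (h : r + c + 1 < pos P d w) : P.Path (lab P d (r + c + 1)) w := by
  obtain ⟨r', d', g1, g2, g3, g4, g5⟩ := trace_back P _ r c d le_rfl hd hs
  rw [← g5]
  refine V hP g2 g3 g4 hw ?_
  have := hP.before g1.le hlt (by rw [pos_lab]; exact h)
  rwa [← g5, pos_lab] at this

lemma path_fwd {P : PipeDream n} (hP : Red P) {r c d w : ℕ} (hd : d + r = c + n)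
    (hs : r + c + 1 ≤ n) (hw : w < n) (hlt : w < lab P d (r + c))
    (h : r + c < pos P d w) : P.Path (lab P d (r + c)) w := by
  obtain ⟨c', d', g1, g2, g3, g4, g5⟩ := trace_fwd P _ r c d le_rfl hd hs
  rw [← g5]
  refine V hP g2 g3 g4 hw ?_
  have := hP.after g1 hlt (by rw [pos_lab]; exact h)
  rwa [← g5, pos_lab] at this

lemma arc_lt (P : PipeDream n) {i j : ℕ} (h : P.Arc i j) : i < n ∧ j < n := by
  obtain ⟨r, c, h1, h2, rfl, rfl⟩ := h
  obtain ⟨d, hd⟩ : ∃ d, d + r = c + n := ⟨c + n - r, by omega⟩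
  rw [west_lab P hd (by omega), south_lab P hd h1]
  exact ⟨lab_lt P (by omega), lab_lt P (by omega)⟩

lemma path_order {P : PipeDream n} {g : Fin n → Fin n}
    (hg : ∀ i j : Fin n, P.Arc i j → g i < g j) {i j : Fin n} (h : P.Path i j) : g i ≤ g j := by
  have : ∀ k : ℕ, P.Path i k → ∀ hk : k < n, g i ≤ g ⟨k, hk⟩ := by
    intro k hk
    induction hk with
    | refl => intro _; exact le_rfl
    | tail _ h2 ih =>
      intro hk
      have h3 := (arc_lt P h2).1
      exact (ih h3).trans (hg ⟨_, h3⟩ ⟨_, hk⟩ h2).le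
  exact this j h j.2

lemma pos_exit {P : PipeDream n} {ω : Equiv.Perm (Fin n)} (h : P.HasExitPerm ω) (k : Fin n) :
    pos P (2 * n) k = (ω⁻¹ k).val := by
  have h1 := h (ω⁻¹ k)
  rw [exit_lab P (ω⁻¹ k).2] at h1
  apply pos_of_lab
  rw [h1]; simp

lemma linExt_le {P : PipeDream n} (hP : Red P) {ω : Equiv.Perm (Fin n)} (h : P.HasExitPerm ω)
    {g : Fin n → Fin n} (hg : ∀ i j : Fin n, P.Arc i j → g i < g j) {i j : Fin n} (hij : i < j)
    (hinv : g j < g i) : ω⁻¹ j < ω⁻¹ i := by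
  by_contra hc
  have hc' : ω⁻¹ i < ω⁻¹ j := by
    refine lt_of_le_of_ne (not_lt.1 hc) ?_
    intro h; have := ω⁻¹.injective h; subst this; exact lt_irrefl _ hij
  have hb : pos P (2 * n) i < pos P (2 * n) j := by
    rw [pos_exit h, pos_exit h]; exact hc'
  obtain ⟨c', d', g1, g2, g3, g4, g5⟩ :=
    trace_fwd P _ i.val 0 (n - i.val) le_rfl (by omega) (by omega)
  rw [add_zero, lab_early P (d := n - i.val) (p := i.val) (by omega)] at g5
  have := hP.before (a := d') (by omega) hij hb
  have h2 := V hP g2 g3 g4 j.2 (by rwa [pos_of_lab P g5.symm] at this)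
  rw [g5] at h2
  exact absurd (path_order hg h2) (not_le.2 hinv)

end PDNet
namespace PDNet

open PipeDream

variable {n : ℕ}

/-- position decreases by at most one per step -/
lemma pos_step (P : PipeDream n) (d e k : ℕ) : pos P d k ≤ pos P (d + e) k + e := by
  induction e with
  | zero => simp
  | succ e ih =>
    have := (f_le P (d + e) (pos P (d + e) k)).2
    show _ ≤ f P (d + e) (pos P (d + e) k) + (e + 1)
    omega

lemma lab_final (P : PipeDream n) {c : ℕ} (h : c < n) : lab P (2 * n) c = lab P (c + n + 1) c := by
  have e : 2 * n = (c + n + 1) + (n - c - 1) := by omega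
  rw [e]
  exact lab_late P (d := c + n + 1) (by omega)

/-- a pipe leaving box `(r, c)` northwards either exits at column `c`, or turns east at some
box above -/
lemma trace_north (P : PipeDream n) : ∀ r c d, d + r = c + n → r + c + 1 ≤ n →
    lab P (d + 1) (r + c) = lab P (2 * n) c ∨
    ∃ r' d', r' < r ∧ d < d' ∧ d' + r' = c + n ∧ P.cross r' c = false ∧
      lab P d' (r' + c + 1) = lab P (d + 1) (r + c) := by
  intro r
  induction r with
  | zero =>
    intro c d h1 h2
    left
    have e : d = c + n := by omega
    rw [lab_final P (by omega), Nat.zero_add, e]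
  | succ r ih =>
    intro c d h1 h2
    have e1 : r + 1 + c = r + c + 1 := by omega
    have hb := X_box P (r := r) (c := c) (d := d + 1) (by omega)
    by_cases hx : P.cross r c = true
    · rw [hx] at hb
      have hl := (lab_succ_X P hb).1
      rcases ih c (d + 1) (by omega) (by omega) with h | ⟨r', d', g1, g2, g3, g4, g5⟩
      · left; rw [e1, ← hl, h]
      · right
        exact ⟨r', d', by omega, by omega, g3, g4, by rw [g5, e1, hl]⟩
    · right
      exact ⟨r, d + 1, by omega, by omega, by omega, by simpa using hx, by rw [e1]⟩

lemma uniq_step {P Q : PipeDream n} (hQ : Red Q) {ω : Equiv.Perm (Fin n)}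
    (hPe : P.HasExitPerm ω) (hQe : Q.HasExitPerm ω)
    {g : Fin n → Fin n} (hgP : ∀ i j : Fin n, P.Arc i j → g i < g j)
    (hgQ : ∀ i j : Fin n, Q.Arc i j → g i < g j) {r c d : ℕ} (hd : d + r = c + n)
    (hlab : ∀ p, lab P d p = lab Q d p) (hp : P.cross r c = false) (hq : Q.cross r c = true) :
    False := by
  have hs := Q.inShape _ _ hq
  have bP := X_box P hd
  have bQ := X_box Q hd
  rw [hp] at bP
  rw [hq] at bQ
  have lP := lab_succ_not P (by omega) bP
  have lQ := lab_succ_X Q bQ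
  have hij := hQ _ _ bQ
  have hi : lab Q d (r + c) < n := lab_lt Q (by omega)
  have hj : lab Q d (r + c + 1) < n := lab_lt Q (by omega)
  have harc : P.Arc (lab Q d (r + c)) (lab Q d (r + c + 1)) :=
    ⟨r, c, hs, hp, by rw [west_lab P hd (by omega), hlab], by rw [south_lab P hd hs, hlab]⟩
  have h1 := hgP ⟨_, hi⟩ ⟨_, hj⟩ harc
  rcases trace_north Q r c d hd (by omega) with h | ⟨r', d', g1, g2, g3, g4, g5⟩
  · have h2 := exit_lab P (c := c) (by omega)
    have h3 := exit_lab Q (c := c) (by omega)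
    rw [hPe ⟨c, by omega⟩] at h2
    rw [hQe ⟨c, by omega⟩] at h3
    rw [← h3, h2, lQ.1, ← hlab, ← lP.2] at h
    rw [lab_final P (by omega)] at h
    have h4 := pos_step P (d + 1) (c + n - d) (lab P (d + 1) (r + c + 1))
    rw [pos_lab, h] at h4
    have e2 : d + 1 + (c + n - d) = c + n + 1 := by omega
    rw [e2, pos_lab] at h4
    omega
  · have bQ' := X_box Q g3
    rw [g4] at bQ'
    have lQ' := lab_succ_not Q (by omega) bQ'
    rw [lQ.1] at g5
    have haf := hQ.after (a := d + 1) (b := d' + 1) (by omega) hij (by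
      rw [← lQ.1, ← lQ.2, pos_lab, pos_lab]; omega)
    rw [← g5, ← lQ'.2, pos_lab] at haf
    have hpath := path_fwd hQ (r := r') (c := c + 1) (d := d' + 1) (w := lab Q d (r + c))
      (by omega) (by omega) hi (by rw [← add_assoc, lQ'.2, g5]; exact hij)
      (by rw [← add_assoc]; exact haf)
    rw [← add_assoc, lQ'.2, g5] at hpath
    have := path_order hgQ (i := ⟨_, hj⟩) (j := ⟨_, hi⟩) hpath
    exact absurd h1 (not_lt.2 this)

lemma uniq {P Q : PipeDream n} (hP : Red P) (hQ : Red Q) {ω : Equiv.Perm (Fin n)}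
    (hPe : P.HasExitPerm ω) (hQe : Q.HasExitPerm ω)
    {g : Fin n → Fin n} (hgP : ∀ i j : Fin n, P.Arc i j → g i < g j)
    (hgQ : ∀ i j : Fin n, Q.Arc i j → g i < g j) : P = Q := by
  have hbox : ∀ d, (∀ p, lab P d p = lab Q d p) → ∀ r c, d + r = c + n →
      P.cross r c = Q.cross r c := by
    intro d hl r c hd
    cases hp : P.cross r c <;> cases hq : Q.cross r c
    · rfl
    · exact (uniq_step hQ hPe hQe hgP hgQ hd hl hp hq).elim
    · exact (uniq_step hP hQe hPe hgQ hgP hd (fun p => (hl p).symm) hq hp).elim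
    · rfl
  have hX : ∀ d, (∀ p, lab P d p = lab Q d p) → ∀ p, X P d p = X Q d p := by
    intro d hl p
    cases hp : X P d p <;> cases hq : X Q d p
    · rfl
    · obtain ⟨r, c, rfl, h2, h3, h4⟩ := X_spec Q hq
      rw [X_box P h2, hbox d hl r c h2, h4] at hp
      exact absurd hp (by simp)
    · obtain ⟨r, c, rfl, h2, h3, h4⟩ := X_spec P hp
      rw [X_box Q h2, ← hbox d hl r c h2, h4] at hq
      exact absurd hq (by simp)
    · rfl
  have hlab : ∀ d p, lab P d p = lab Q d p := by
    intro d
    induction d with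
    | zero => intro p; rfl
    | succ d ih =>
      intro p
      have hx := hX d ih
      simp only [lab, f, hx, ih]
  have hc : P.cross = Q.cross := by
    funext r c
    by_cases h : r + c + 2 ≤ n
    · exact hbox (c + n - r) (hlab _) r c (by omega)
    · have h1 : P.cross r c = false := by
        by_contra hh; exact h (P.inShape r c (by simpa using hh))
      have h2 : Q.cross r c = false := by
        by_contra hh; exact h (Q.inShape r c (by simpa using hh))
      rw [h1, h2]
  cases P; cases Q; cases hc; rfl

lemma arc_iff (P : PipeDream n) {i j : ℕ} : P.Arc i j ↔ ∃ r c d, d + r = c + n ∧ r + c + 2 ≤ n ∧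
    P.cross r c = false ∧ lab P d (r + c) = i ∧ lab P d (r + c + 1) = j := by
  constructor
  · rintro ⟨r, c, h1, h2, rfl, rfl⟩
    have hd : c + n - r + r = c + n := by omega
    exact ⟨r, c, c + n - r, hd, h1, h2, (west_lab P hd (by omega)).symm, (south_lab P hd h1).symm⟩
  · rintro ⟨r, c, d, hd, h1, h2, rfl, rfl⟩
    exact ⟨r, c, h1, h2, west_lab P hd (by omega), south_lab P hd h1⟩

lemma K_down {P : PipeDream n} (hP : Red P) {x y z : ℕ} (hxy : x < y) (hyz : y < z)
    (hz : z < n) (h : P.Arc z x) : P.Path y z ∨ P.Path x y := by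
  obtain ⟨r, c, d, hd, hs, hx, hi, hj⟩ := (arc_iff P).1 h
  have pz := pos_of_lab P hi.symm
  have px := pos_of_lab P hj.symm
  rcases lt_trichotomy (pos P d y) (pos P d z) with h1 | h1 | h1
  · left
    obtain ⟨m, _, hm, g1, g2⟩ := exists_crossing P (i := x) (j := y) (a := 0) (b := d) (by omega)
      hxy (by omega)
    obtain ⟨r', c', q1, q2, q3, q4⟩ := X_spec P g1
    have hl : lab P m (r' + c' + 1) = y := by rw [← q1, ← g2, lab_pos]
    have hb := hP.before (a := m) (b := d) (by omega) hyz h1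
    have := path_back hP q2 q3 hz (by rw [hl]; exact hyz) (by omega)
    rwa [hl] at this
  · have := pos_inj P h1; omega
  · right
    have hne : pos P d y ≠ pos P d x := by intro h; have := pos_inj P h; omega
    have := path_back hP hd hs (w := y) (by omega) (by omega) (by omega)
    rwa [hj] at this

lemma K_up {P : PipeDream n} (hP : Red P) {x y z : ℕ} (hxy : x < y) (hyz : y < z)
    (hz : z < n) (hiyz : pos P (2 * n) z < pos P (2 * n) y) (h : P.Arc x z) :
    P.Path y x ∨ P.Path z y := by
  obtain ⟨r, c, d, hd, hs, hx, hi, hj⟩ := (arc_iff P).1 h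
  have px := pos_of_lab P hi.symm
  have pz := pos_of_lab P hj.symm
  rcases lt_trichotomy (pos P d y) (pos P d x) with h1 | h1 | h1
  · left
    obtain ⟨m, hm, _, g1, g2⟩ := exists_crossing P (i := y) (j := z) (a := d) (b := 2 * n)
      (by omega) (by omega) (by omega)
    obtain ⟨r', c', q1, q2, q3, q4⟩ := X_spec P g1
    have hl : lab P m (r' + c') = y := by rw [← q1, lab_pos]
    have hb := hP.after (a := d) (b := m) (by omega) hxy h1
    have := path_fwd hP q2 (by omega) (w := x) (by omega) (by rw [hl]; exact hxy) (by omega)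
    rwa [hl] at this
  · have := pos_inj P h1; omega
  · right
    have hne : pos P d y ≠ pos P d z := by intro h; have := pos_inj P h; omega
    have hb := X_box P hd
    rw [hx] at hb
    have hl := (lab_succ_not P (by omega) hb).2
    rw [hj] at hl
    have pz' := pos_of_lab P hl.symm
    have ha := hP.after (a := d) (b := d + 1) (by omega) hyz (by omega)
    have := path_fwd hP (r := r) (c := c + 1) (d := d + 1) (w := y) (by omega) (by omega)
      (by omega) (by rw [← add_assoc, hl]; exact hyz) (by omega)
    rwa [← add_assoc, hl] at this

end PDNet
namespace PDNet

open PipeDream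

variable {n : ℕ}

lemma cross_uniq {P : PipeDream n} (hP : Red P) {d p d' p' : ℕ} (h1 : X P d p = true)
    (h2 : X P d' p' = true) (h4 : lab P d p = lab P d' p')
    (h5 : lab P d (p + 1) = lab P d' (p' + 1)) : d = d' ∧ p = p' := by
  have key : ∀ d p d' p', X P d p = true → X P d' p' = true → d < d' →
      lab P d p = lab P d' p' → lab P d (p + 1) = lab P d' (p' + 1) → False := by
    intro d p d' p' h1 h2 h3 h4 h5
    have := hP.after (i := lab P d p) (j := lab P d (p + 1)) (a := d + 1) (b := d') (by omega)
      (hP d p h1) (by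
        rw [← (lab_succ_X P h1).1, ← (lab_succ_X P h1).2, pos_lab, pos_lab]; omega)
    rw [h4, h5, pos_lab, pos_lab] at this
    omega
  rcases lt_trichotomy d d' with h | h | h
  · exact (key _ _ _ _ h1 h2 h h4 h5).elim
  · subst h
    exact ⟨rfl, lab_inj P h4⟩
  · exact (key _ _ _ _ h2 h1 h h4.symm h5.symm).elim

/-- toggling two boxes -/
def tog (P : PipeDream n) (r0 c0 r1 c1 : ℕ) (h0 : r0 + c0 + 2 ≤ n) (h1 : r1 + c1 + 2 ≤ n) :
    PipeDream n where
  cross r c := if (r = r0 ∧ c = c0) ∨ (r = r1 ∧ c = c1) then !P.cross r c else P.cross r c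
  inShape r c h := by
    split_ifs at h with h'
    · omega
    · exact P.inShape r c h

lemma X_tog (P : PipeDream n) {r0 c0 r1 c1 d0 d1 : ℕ} (h0 : r0 + c0 + 2 ≤ n)
    (h1 : r1 + c1 + 2 ≤ n) (hd0 : d0 + r0 = c0 + n) (hd1 : d1 + r1 = c1 + n) (d p : ℕ) :
    X (tog P r0 c0 r1 c1 h0 h1) d p =
      if (d = d0 ∧ p = r0 + c0) ∨ (d = d1 ∧ p = r1 + c1) then !X P d p else X P d p := by
  by_cases hv : ∃ r c, p = r + c ∧ d + r = c + n
  · obtain ⟨r, c, rfl, hd⟩ := hv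
    rw [X_box _ hd, X_box _ hd]
    have : ((d = d0 ∧ r + c = r0 + c0) ∨ (d = d1 ∧ r + c = r1 + c1)) ↔
      ((r = r0 ∧ c = c0) ∨ (r = r1 ∧ c = c1)) := by omega
    simp only [this]
    rfl
  · have hf : ∀ Q : PipeDream n, X Q d p = false := by
      intro Q
      by_contra hc
      obtain ⟨r, c, g1, g2, _, _⟩ := X_spec Q (by simpa using hc)
      exact hv ⟨r, c, g1, g2⟩
    rw [hf, hf, if_neg]
    rintro (⟨rfl, rfl⟩ | ⟨rfl, rfl⟩)
    · exact hv ⟨r0, c0, rfl, hd0⟩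
    · exact hv ⟨r1, c1, rfl, hd1⟩

lemma f_congr {P Q : PipeDream n} {d : ℕ} (h : ∀ p, X Q d p = X P d p) (p : ℕ) :
    f Q d p = f P d p := by
  simp only [f, h]

lemma f_tog {P Q : PipeDream n} {d p0 : ℕ} (hpar : (d + p0 + n) % 2 = 0)
    (h0 : X Q d p0 = !X P d p0) (ho : ∀ p, p ≠ p0 → X Q d p = X P d p) (p : ℕ) :
    f Q d p = Equiv.swap p0 (p0 + 1) (f P d p) := by
  by_cases hp0 : p = p0 ∨ p = p0 + 1
  · cases hx : X P d p0 with
    | true =>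
      rw [hx] at h0
      have h1 := f_of_X P hx
      have h2 := f_of_not Q hpar h0
      rcases hp0 with rfl | rfl
      · rw [h1.1, h2.1, Equiv.swap_apply_right]
      · rw [h1.2, h2.2, Equiv.swap_apply_left]
    | false =>
      rw [hx] at h0
      have h1 := f_of_X Q h0
      have h2 := f_of_not P hpar hx
      rcases hp0 with rfl | rfl
      · rw [h1.1, h2.1, Equiv.swap_apply_left]
      · rw [h1.2, h2.2, Equiv.swap_apply_right]
  · have e : f Q d p = f P d p := by
      unfold f
      rw [ho p (by tauto)]
      by_cases hz : p = 0
      · simp [hz]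
      · rw [ho (p - 1) (by omega)]
    have hset : f P d p ≠ p0 ∧ f P d p ≠ p0 + 1 := by
      have h3 := f_f P d p
      cases hx : X P d p0 with
      | true =>
        have h1 := f_of_X P hx
        constructor <;> intro h <;> rw [h] at h3 <;> omega
      | false =>
        have h1 := f_of_not P hpar hx
        constructor <;> intro h <;> rw [h] at h3 <;> omega
    rw [e, Equiv.swap_apply_of_ne_of_ne hset.1 hset.2]

lemma lab_swap (P : PipeDream n) (d p q x : ℕ) :
    lab P d (Equiv.swap p q x) = Equiv.swap (lab P d p) (lab P d q) (lab P d x) := by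
  rcases eq_or_ne x p with rfl | h1
  · simp
  rcases eq_or_ne x q with rfl | h2
  · simp
  rw [Equiv.swap_apply_of_ne_of_ne h1 h2, Equiv.swap_apply_of_ne_of_ne]
  · intro h; exact h1 (lab_inj P h)
  · intro h; exact h2 (lab_inj P h)

/-- the relabelling at time `d` -/
def rel (d0 d1 a b d : ℕ) : Equiv.Perm ℕ := if d0 < d ∧ d ≤ d1 then Equiv.swap a b else 1

section

variable {P Q : PipeDream n} {d0 d1 p0 p1 a b : ℕ}

lemma lab_tog (hlt : d0 < d1)
    (hX : ∀ d p, X Q d p = if (d = d0 ∧ p = p0) ∨ (d = d1 ∧ p = p1) then !X P d p else X P d p)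
    (hpar0 : (d0 + p0 + n) % 2 = 0) (hpar1 : (d1 + p1 + n) % 2 = 0)
    (hl0 : Equiv.swap (lab P d0 p0) (lab P d0 (p0 + 1)) = Equiv.swap a b)
    (hl1 : Equiv.swap (lab P d1 p1) (lab P d1 (p1 + 1)) = Equiv.swap a b) (d p : ℕ) :
    lab Q d p = rel d0 d1 a b d (lab P d p) := by
  induction d generalizing p with
  | zero => simp [rel, lab]
  | succ d ih =>
    simp only [lab]
    rw [ih]
    by_cases h0 : d = d0
    · subst h0
      rw [f_tog (P := P) (p0 := p0) hpar0 (by simp [hX]) (by intro p hp; rw [hX, if_neg (by omega)]),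
        lab_swap, hl0]
      have e1 : rel d d1 a b d = 1 := by simp [rel]
      have e2 : rel d d1 a b (d + 1) = Equiv.swap a b := by
        rw [rel, if_pos (by omega)]
      rw [e1, e2]; rfl
    · by_cases h1 : d = d1
      · subst h1
        rw [f_tog (P := P) (p0 := p1) hpar1 (by simp [hX])
          (by intro p hp; rw [hX, if_neg (by omega)]), lab_swap, hl1]
        have e1 : rel d0 d a b d = Equiv.swap a b := by rw [rel, if_pos (by omega)]
        have e2 : rel d0 d a b (d + 1) = 1 := by
          rw [rel, if_neg (by omega)]
        rw [e1, e2, Equiv.swap_apply_self]; rfl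
      · rw [f_congr (P := P) (Q := Q) (by intro p; rw [hX, if_neg (by omega)])]
        have : rel d0 d1 a b (d + 1) = rel d0 d1 a b d := by
          unfold rel
          have : (d0 < d + 1 ∧ d + 1 ≤ d1) ↔ (d0 < d ∧ d ≤ d1) := by omega
          simp only [this]
        rw [this]

/-- swapping one of the two labels of a crossing in the interval -/
lemma red_aux (hP : Red P) {u v : ℕ} {d p : ℕ} (hx : X P d p = true) (hd0 : d0 < d) (hd1 : d < d1)
    (hu : lab P d p = u) (hv : lab P d (p + 1) = v)
    {u' v' : ℕ} (h0 : pos P d0 u < pos P d0 v → pos P d0 u' < pos P d0 v')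
    (h1 : pos P d1 v < pos P d1 u → pos P d1 v' < pos P d1 u') : u' < v' := by
  have huv := hP _ _ hx
  have l := lab_succ_X P hx
  rw [hu, hv] at huv l
  refine hP.order (a := d0) (b := d1) (by omega) (h0 ?_) (h1 ?_)
  · refine hP.before (b := d) (by omega) huv ?_
    rw [pos_of_lab P hu.symm, pos_of_lab P hv.symm]; omega
  · refine hP.after (a := d + 1) (by omega) huv ?_
    rw [pos_of_lab P l.1.symm, pos_of_lab P l.2.symm]; omega

lemma red_tog (hP : Red P) (hlt : d0 < d1) (hab : a < b)
    (hX : ∀ d p, X Q d p = if (d = d0 ∧ p = p0) ∨ (d = d1 ∧ p = p1) then !X P d p else X P d p)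
    (hpar1 : (d1 + p1 + n) % 2 = 0)
    (hl : ∀ d p, lab Q d p = rel d0 d1 a b d (lab P d p))
    (ha0 : lab P d0 p0 = a) (hb0 : lab P d0 (p0 + 1) = b)
    (h1 : (lab P d1 p1 = a ∧ lab P d1 (p1 + 1) = b ∧ X P d1 p1 = true) ∨
      (lab P d1 p1 = b ∧ lab P d1 (p1 + 1) = a))
    (hone : ∀ d p, X P d p = true → lab P d p = a → lab P d (p + 1) = b →
      (d = d0 ∧ p = p0) ∨ (d = d1 ∧ p = p1)) : Red Q := by
  have qa0 := pos_of_lab P ha0.symm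
  have qb0 := pos_of_lab P hb0.symm
  have q1 : (pos P d1 a = p1 ∧ pos P d1 b = p1 + 1) ∨ (pos P d1 b = p1 ∧ pos P d1 a = p1 + 1) := by
    rcases h1 with ⟨g1, g2, _⟩ | ⟨g1, g2⟩
    · left; exact ⟨pos_of_lab P g1.symm, pos_of_lab P g2.symm⟩
    · right; exact ⟨pos_of_lab P g1.symm, pos_of_lab P g2.symm⟩
  intro d p hx
  rw [hl, hl]
  by_cases e0 : d = d0 ∧ p = p0
  · obtain ⟨rfl, rfl⟩ := e0
    rw [ha0, hb0, rel, if_neg (by omega)]; exact hab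
  by_cases e1 : d = d1 ∧ p = p1
  · obtain ⟨rfl, rfl⟩ := e1
    rw [hX, if_pos (by omega)] at hx
    rcases h1 with ⟨_, _, g⟩ | ⟨g1, g2⟩
    · rw [g] at hx; simp at hx
    · rw [g1, g2, rel, if_pos (by omega), Equiv.swap_apply_left, Equiv.swap_apply_right]
      exact hab
  rw [hX, if_neg (by tauto)] at hx
  have huv := hP _ _ hx
  by_cases hin : d0 < d ∧ d ≤ d1
  swap
  · rw [rel, if_neg hin]; exact huv
  rw [rel, if_pos hin]
  by_cases hd1 : d = d1
  · subst hd1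
    have hpar := X_lt P hx
    have key : ∀ q, q ≠ p1 → q ≠ p1 + 1 → lab P d q ≠ a ∧ lab P d q ≠ b := by
      intro q n1 n2
      constructor <;> intro h <;> have := pos_of_lab P h.symm <;> omega
    have k1 := key p (by omega) (by omega)
    have k2 := key (p + 1) (by omega) (by omega)
    rw [Equiv.swap_apply_of_ne_of_ne k1.1 k1.2, Equiv.swap_apply_of_ne_of_ne k2.1 k2.2]
    exact huv
  have hd1' : d < d1 := by omega
  obtain ⟨u, hu⟩ : ∃ u, lab P d p = u := ⟨_, rfl⟩
  obtain ⟨v, hv⟩ : ∃ v, lab P d (p + 1) = v := ⟨_, rfl⟩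
  rw [hu, hv] at huv ⊢
  have haux := @red_aux n P d0 d1 hP u v d p hx hin.1 hd1' hu hv
  have hnot : ¬ (u = a ∧ v = b) := by
    rintro ⟨rfl, rfl⟩
    rcases hone d p hx hu hv with h | h
    · exact e0 h
    · exact e1 h
  have inj0 : ∀ {x y}, x ≠ y → pos P d0 x ≠ pos P d0 y := fun h h' => h (pos_inj P h')
  have inj1 : ∀ {x y}, x ≠ y → pos P d1 x ≠ pos P d1 y := fun h h' => h (pos_inj P h')
  by_cases hua : u = a
  · subst hua
    have hvb : v ≠ b := by tauto
    have hvu : v ≠ u := by omega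
    rw [Equiv.swap_apply_left, Equiv.swap_apply_of_ne_of_ne hvu hvb]
    have i1 := inj0 hvb; have i2 := inj1 hvb; have i3 := inj0 hvu; have i4 := inj1 hvu
    exact haux (by omega) (by omega)
  by_cases hub : u = b
  · subst hub
    have hva : v ≠ a := by omega
    have hvu : v ≠ u := by omega
    rw [Equiv.swap_apply_right, Equiv.swap_apply_of_ne_of_ne hva hvu]
    have i1 := inj0 hva; have i2 := inj1 hva; have i3 := inj0 hvu; have i4 := inj1 hvu
    exact haux (by omega) (by omega)
  rw [Equiv.swap_apply_of_ne_of_ne hua hub]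
  have i1 := inj0 hua; have i2 := inj1 hua; have i3 := inj0 hub; have i4 := inj1 hub
  by_cases hva : v = a
  · subst hva
    rw [Equiv.swap_apply_left]
    exact haux (by omega) (by omega)
  by_cases hvb : v = b
  · subst hvb
    rw [Equiv.swap_apply_right]
    exact haux (by omega) (by omega)
  rw [Equiv.swap_apply_of_ne_of_ne hva hvb]
  exact huv

end

/-- `a → b` contact at time `d` in box `(r, c)` -/
def Con (P : PipeDream n) (a b d r c : ℕ) : Prop :=
  d + r = c + n ∧ r + c + 2 ≤ n ∧ P.cross r c = false ∧ lab P d (r + c) = a ∧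
    lab P d (r + c + 1) = b

/-- common part of the two flips; `lo < hi` are the two pipes and `a → b` is the arc to be
reversed -/
lemma flip_core {P : PipeDream n} (hP : Red P) {ω : Equiv.Perm (Fin n)} (he : P.HasExitPerm ω)
    {lo hi a b r0 c0 r1 c1 d0 d1 : ℕ} (hlt : d0 < d1) (hlohi : lo < hi)
    (hset : (a = lo ∧ b = hi ∧ P.cross r1 c1 = true) ∨ (a = hi ∧ b = lo ∧ P.cross r0 c0 = true))
    (s0 : r0 + c0 + 2 ≤ n) (s1 : r1 + c1 + 2 ≤ n) (t0 : d0 + r0 = c0 + n) (t1 : d1 + r1 = c1 + n)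
    (hne : P.cross r1 c1 = !P.cross r0 c0)
    (ha0 : lab P d0 (r0 + c0) = lo) (hb0 : lab P d0 (r0 + c0 + 1) = hi)
    (ha1 : lab P d1 (r1 + c1) = a) (hb1 : lab P d1 (r1 + c1 + 1) = b)
    (hba : ¬ P.Arc b a)
    (hcon : ∀ d r c, Con P a b d r c → (d0 ≤ d ∧ d ≤ d1)) :
    ∃ Q : PipeDream n, Red Q ∧ Q.HasExitPerm ω ∧ ∀ u v, Q.Arc u v → (u = b ∧ v = a) ∨
      (¬ (u = a ∧ v = b) ∧ (P.Arc u v ∨ P.Arc (Equiv.swap a b u) (Equiv.swap a b v))) := by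
  have hX := X_tog P s0 s1 t0 t1
  have hswap : Equiv.swap lo hi = Equiv.swap a b := by
    rcases hset with ⟨rfl, rfl, _⟩ | ⟨rfl, rfl, _⟩
    · rfl
    · exact Equiv.swap_comm _ _
  have hl := lab_tog (a := lo) (b := hi) hlt hX (by omega) (by omega) (by rw [ha0, hb0])
    (by rw [ha1, hb1, hswap])
  have b0 := X_box P t0
  have b1 := X_box P t1
  refine ⟨tog P r0 c0 r1 c1 s0 s1, ?_, ?_, ?_⟩
  · refine red_tog hP hlt hlohi hX (by omega) hl ha0 hb0 ?_ ?_
    · rcases hset with ⟨rfl, rfl, h⟩ | ⟨rfl, rfl, h⟩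
      · left; exact ⟨ha1, hb1, by rw [b1, h]⟩
      · right; exact ⟨ha1, hb1⟩
    · intro d p hx h1 h2
      rcases hset with ⟨rfl, rfl, h⟩ | ⟨rfl, rfl, h⟩
      · right
        exact cross_uniq hP hx (by rw [b1, h]) (by rw [h1, ha1]) (by rw [h2, hb1])
      · left
        exact cross_uniq hP hx (by rw [b0, h]) (by rw [h1, ha0]) (by rw [h2, hb0])
  · intro c
    rw [exit_lab _ c.2, hl, rel, if_neg (by omega), ← he c, exit_lab _ c.2]; rfl
  · intro u v h
    obtain ⟨r, c, d, hd, hs, hx, hu, hv⟩ := (arc_iff _).1 h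
    rw [hl] at hu hv
    by_cases e0 : r = r0 ∧ c = c0
    · obtain ⟨rfl, rfl⟩ := e0
      have : d = d0 := by omega
      subst this
      have hc : P.cross r c = true := by
        simpa [tog] using hx
      rw [rel, if_neg (by omega)] at hu hv
      rw [ha0] at hu
      rw [hb0] at hv
      left
      rcases hset with ⟨rfl, rfl, h⟩ | ⟨rfl, rfl, h⟩
      · rw [hne, hc] at h; simp at h
      · exact ⟨hu.symm, hv.symm⟩
    by_cases e1 : r = r1 ∧ c = c1
    · obtain ⟨rfl, rfl⟩ := e1
      have : d = d1 := by omega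
      subst this
      rw [rel, if_pos (by omega), hswap] at hu hv
      rw [ha1, Equiv.swap_apply_left] at hu
      rw [hb1, Equiv.swap_apply_right] at hv
      left; exact ⟨hu.symm, hv.symm⟩
    right
    have hc : P.cross r c = false := by
      have : ¬ ((r = r0 ∧ c = c0) ∨ (r = r1 ∧ c = c1)) := by tauto
      simpa [tog, this] using hx
    have harc : P.Arc (lab P d (r + c)) (lab P d (r + c + 1)) :=
      (arc_iff P).2 ⟨r, c, d, hd, hs, hc, rfl, rfl⟩
    by_cases hin : d0 < d ∧ d ≤ d1
    · rw [rel, if_pos hin, hswap] at hu hv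
      have hu' : lab P d (r + c) = Equiv.swap a b u := by rw [← hu, Equiv.swap_apply_self]
      have hv' : lab P d (r + c + 1) = Equiv.swap a b v := by rw [← hv, Equiv.swap_apply_self]
      rw [hu', hv'] at harc
      refine ⟨?_, Or.inr harc⟩
      rintro ⟨rfl, rfl⟩
      rw [Equiv.swap_apply_left, Equiv.swap_apply_right] at harc
      exact hba harc
    · rw [rel, if_neg hin] at hu hv
      have hu' : lab P d (r + c) = u := hu
      have hv' : lab P d (r + c + 1) = v := hv
      rw [hu', hv'] at harc
      refine ⟨?_, Or.inl harc⟩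
      rintro ⟨rfl, rfl⟩
      have h1 := hcon d r c ⟨hd, hs, hc, hu', hv'⟩
      have hdd : d = d0 := by omega
      subst hdd
      have : r + c = r0 + c0 := by
        have z1 := pos_of_lab P hu'.symm
        have z2 := pos_of_lab P hv'.symm
        have z3 := pos_of_lab P ha0.symm
        have z4 := pos_of_lab P hb0.symm
        rcases hset with ⟨rfl, rfl, _⟩ | ⟨rfl, rfl, _⟩ <;> omega
      omega

lemma flip {P : PipeDream n} (hP : Red P) {ω : Equiv.Perm (Fin n)} (he : P.HasExitPerm ω)
    {a b : ℕ} (harc : P.Arc a b) (hba : ¬ P.Arc b a)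
    (hinv : (a < b ∧ pos P (2 * n) b < pos P (2 * n) a) ∨
      (b < a ∧ pos P (2 * n) a < pos P (2 * n) b)) :
    ∃ Q : PipeDream n, Red Q ∧ Q.HasExitPerm ω ∧ ∀ u v, Q.Arc u v → (u = b ∧ v = a) ∨
      (¬ (u = a ∧ v = b) ∧ (P.Arc u v ∨ P.Arc (Equiv.swap a b u) (Equiv.swap a b v))) := by
  classical
  obtain ⟨r, c, d, hcd⟩ : ∃ r c d, Con P a b d r c := (arc_iff P).1 harc
  have hposcon : ∀ {d r c}, Con P a b d r c → pos P d a = r + c ∧ pos P d b = r + c + 1 := by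
    rintro d r c ⟨_, _, _, h1, h2⟩
    exact ⟨pos_of_lab P h1.symm, pos_of_lab P h2.symm⟩
  rcases hinv with ⟨hab, hi⟩ | ⟨hab, hi⟩
  · have hex : ∃ d, ∃ r c, Con P a b d r c := ⟨d, r, c, hcd⟩
    obtain ⟨r0, c0, hc0⟩ := Nat.find_spec hex
    have hmin : ∀ d r c, Con P a b d r c → Nat.find hex ≤ d := fun d r c h =>
      Nat.find_min' hex ⟨r, c, h⟩
    generalize Nat.find hex = d0 at hc0 hmin
    obtain ⟨d1, _, hd1, x1, x2⟩ := exists_crossing P (i := a) (j := b) (a := 0) (b := 2 * n)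
      (by omega) hab hi
    obtain ⟨r1, c1, q1, q2, q3, q4⟩ := X_spec P x1
    have hl := lab_succ_X P x1
    have la : lab P d1 (pos P d1 a) = a := lab_pos ..
    have lb : lab P d1 (pos P d1 a + 1) = b := by rw [← x2, lab_pos]
    rw [la, lb] at hl
    have hmax : ∀ d r c, Con P a b d r c → d < d1 := by
      intro d r c h
      obtain ⟨w1, w2⟩ := hposcon h
      obtain ⟨w3, w4, w5, w6, w7⟩ := h
      by_contra hc
      rcases eq_or_lt_of_le (not_lt.1 hc) with h | h
      · subst h
        have : r = r1 ∧ c = c1 := by omega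
        rw [this.1, this.2, q4] at w5; simp at w5
      · have := hP.after (a := d1 + 1) (b := d) (by omega) hab (by
          rw [pos_of_lab P hl.1.symm, pos_of_lab P hl.2.symm]; omega)
        omega
    have h01 := hmax _ _ _ hc0
    obtain ⟨w3, w4, w5, w6, w7⟩ := hc0
    rw [q1] at la lb
    exact flip_core hP he h01 hab (Or.inl ⟨rfl, rfl, q4⟩) w4 q3 w3 q2 (by rw [q4, w5]; rfl)
      w6 w7 la lb hba (fun d r c h => ⟨hmin d r c h, (hmax d r c h).le⟩)
  · obtain ⟨d0, _, hd0, x1, x2⟩ := exists_crossing P (i := b) (j := a) (a := 0) (b := 2 * n)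
      (by omega) hab hi
    obtain ⟨r0, c0, q1, q2, q3, q4⟩ := X_spec P x1
    have lb : lab P d0 (pos P d0 b) = b := lab_pos ..
    have la : lab P d0 (pos P d0 b + 1) = a := by rw [← x2, lab_pos]
    have hmin : ∀ d r c, Con P a b d r c → d0 < d := by
      intro d r c h
      obtain ⟨w1, w2⟩ := hposcon h
      by_contra hc
      have := hP.before (a := d) (b := d0) (not_lt.1 hc) hab (by omega)
      omega
    have hfin : ∃ d1, (∃ r c, Con P a b d1 r c) ∧ ∀ d r c, Con P a b d r c → d ≤ d1 := by
      have hle : ∀ d, (∃ r c, Con P a b d r c) → d ≤ 2 * n := by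
        rintro d ⟨r, c, h⟩
        obtain ⟨w3, w4, _⟩ := h
        omega
      refine ⟨Nat.findGreatest (fun d => ∃ r c, Con P a b d r c) (2 * n), ?_, ?_⟩
      · exact Nat.findGreatest_spec (P := fun d => ∃ r c, Con P a b d r c) (hle d ⟨r, c, hcd⟩)
          ⟨r, c, hcd⟩
      · intro d r c h
        exact Nat.le_findGreatest (hle d ⟨r, c, h⟩) ⟨r, c, h⟩
    obtain ⟨d1, ⟨r1, c1, hc1⟩, hmax⟩ := hfin
    have h01 := hmin _ _ _ hc1
    obtain ⟨w3, w4, w5, w6, w7⟩ := hc1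
    rw [q1] at la lb
    exact flip_core hP he h01 hab (Or.inr ⟨rfl, rfl, q4⟩) q3 w4 q2 w3 (by rw [q4, w5]; rfl)
      lb la w6 w7 hba (fun d r c h => ⟨(hmin d r c h).le, hmax d r c h⟩)

end PDNet
namespace PDNet

open PipeDream PDComb

variable {n : ℕ}

lemma flipF (inst : DecidableEq (Fin n)) {P : PipeDream n} (hP : Red P)
    {ω : Equiv.Perm (Fin n)} (he : P.HasExitPerm ω) (g : Fin n ≃ Fin n)
    (hg : ∀ i j : Fin n, P.Arc i j → g i < g j) {a b : Fin n} (hadj : (g a).val + 1 = (g b).val)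
    (harc : P.Arc a b)
    (hinv : (a < b ∧ ω⁻¹ b < ω⁻¹ a) ∨ (b < a ∧ ω⁻¹ a < ω⁻¹ b)) :
    ∃ Q : PipeDream n, Red Q ∧ Q.HasExitPerm ω ∧
      (∀ u v : Fin n, Q.Arc u v →
        g (@Equiv.swap _ inst b a u) < g (@Equiv.swap _ inst b a v)) ∧
      ∀ u v : Fin n, Q.Arc u v → (u = b ∧ v = a) ∨ P.Arc u v ∨
        P.Arc (@Equiv.swap _ inst b a u).val (@Equiv.swap _ inst b a v).val := by
  obtain rfl : inst = instDecidableEqFin n := Subsingleton.elim _ _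
  have hba : ¬ P.Arc b a := by
    intro h; have := hg _ _ h; rw [Fin.lt_def] at this; omega
  have hswap : ∀ u : Fin n, Equiv.swap a.val b.val u.val = (Equiv.swap b a u).val := by
    intro u
    rcases eq_or_ne u a with rfl | h1
    · simp
    rcases eq_or_ne u b with rfl | h2
    · simp
    rw [Equiv.swap_apply_of_ne_of_ne h2 h1, Equiv.swap_apply_of_ne_of_ne]
    · intro h; exact h1 (Fin.ext h)
    · intro h; exact h2 (Fin.ext h)
  obtain ⟨Q, h1, h2, h3⟩ := flip hP he harc hba (by
    rw [pos_exit he, pos_exit he]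
    rcases hinv with h | h
    · left; exact h
    · right; exact h)
  have hsw : ∀ u : Fin n, g (Equiv.swap b a u) = sw g b a u := by
    intro u
    rcases eq_or_ne u b with rfl | hb
    · rw [sw_left, Equiv.swap_apply_left]
    rcases eq_or_ne u a with rfl | ha
    · rw [sw_right, Equiv.swap_apply_right]
    rw [sw_other g hb ha, Equiv.swap_apply_of_ne_of_ne hb ha]
  refine ⟨Q, h1, h2, ?_, ?_⟩
  · intro u v h
    rcases h3 u v h with ⟨hu, hv⟩ | ⟨hne, h | h⟩
    · rw [Fin.ext hu, Fin.ext hv, Equiv.swap_apply_left, Equiv.swap_apply_right, Fin.lt_def]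
      omega
    · by_cases hub : u = b ∧ v = a
      · rw [hub.1, hub.2, Equiv.swap_apply_left, Equiv.swap_apply_right, Fin.lt_def]
        omega
      · rw [hsw, hsw]
        refine (sw_lt_iff g hadj ?_ hub).2 (hg _ _ h)
        rintro ⟨rfl, rfl⟩; exact hne ⟨rfl, rfl⟩
    · rw [hswap, hswap] at h
      exact hg _ _ h
  · intro u v h
    rcases h3 u v h with ⟨hu, hv⟩ | ⟨hne, h | h⟩
    · left; exact ⟨Fin.ext hu, Fin.ext hv⟩
    · right; left; exact h
    · right; right; rwa [hswap, hswap] at h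

/-- the pipe dreams of `Π(ω)` -/
abbrev PD (ω : Equiv.Perm (Fin n)) : Type := {P : PipeDream n // Red P ∧ P.HasExitPerm ω}

theorem down_primal (ω : Equiv.Perm (Fin n)) (P' P : PD ω) (t r s : Fin n ≃ Fin n)
    (h1 : ∀ i j : Fin n, P'.1.Arc i j → t i < t j) (h2 : ∀ i j : Fin n, P'.1.Arc i j → r i < r j)
    (h3 : ∀ i j : Fin n, i < j → r j < r i → t j < t i)
    (h4 : ∀ i j : Fin n, P.1.Arc i j → s i < s j)
    (h5 : ∀ i j : Fin n, i < j → s j < s i → t j < t i) :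
    ∃ p : Fin n ≃ Fin n, (∀ i j : Fin n, P.1.Arc i j → p i < p j) ∧
      ∀ i j : Fin n, i < j → p j < p i → r j < r i := by
  refine class_down (α := Fin n) (O := PD ω) (fun P i j => P.1.Arc i.val j.val) ?_ ?_ ?_ _ t
    (Nat.lt_succ_self _) P' P r s h1 h2 h3 h4 h5
  · intro P Q g hP hQ
    exact Subtype.ext (uniq P.2.1 Q.2.1 P.2.2 Q.2.2 hP hQ)
  · intro P g c d hg hcd hadj harc _
    have hgl : g d < g c := by rw [Fin.lt_def]; omega
    obtain ⟨Q, q1, q2, q3, q4⟩ := flipF _ P.2.1 P.2.2 g hg hadj harc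
      (Or.inr ⟨hcd, linExt_le P.2.1 P.2.2 hg hcd hgl⟩)
    exact ⟨⟨Q, q1, q2⟩, q3, q4⟩
  · intro P g x y z hg hxy hyz hzy hyx _ _ harc
    rcases K_down P.2.1 (x := x.val) (y := y.val) (z := z.val) hxy hyz z.2 harc with h | h
    · exact absurd (path_order hg h) (not_le.2 hzy)
    · exact absurd (path_order hg h) (not_le.2 hyx)

theorem down_dual (ω : Equiv.Perm (Fin n)) (P' P : PD ω) (t r s : Fin n ≃ Fin n)
    (h1 : ∀ i j : Fin n, P'.1.Arc i j → t i < t j) (h2 : ∀ i j : Fin n, P'.1.Arc i j → r i < r j)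
    (h3 : ∀ i j : Fin n, j < i → r j < r i → t j < t i)
    (h4 : ∀ i j : Fin n, P.1.Arc i j → s i < s j)
    (h5 : ∀ i j : Fin n, j < i → s j < s i → t j < t i) :
    ∃ p : Fin n ≃ Fin n, (∀ i j : Fin n, P.1.Arc i j → p i < p j) ∧
      ∀ i j : Fin n, j < i → p j < p i → r j < r i := by
  refine class_down (α := (Fin n)ᵒᵈ) (O := PD ω)
    (fun P (i j : Fin n) => P.1.Arc i.val j.val) ?_ ?_ ?_ _ t
    (Nat.lt_succ_self _) P' P r s h1 h2 h3 h4 h5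
  · intro P Q g hP hQ
    exact Subtype.ext (uniq P.2.1 Q.2.1 P.2.2 Q.2.2 hP hQ)
  · rintro P g c d hg hcd hadj harc ⟨Q, k, hQ, hk⟩
    have hgl : g d < g c := by rw [Fin.lt_def]; omega
    have hdc : @LT.lt (Fin n) _ d c := hcd
    have hkk : k c < k d := by
      by_contra hc
      have hne : k d ≠ k c := fun h => hcd.ne' (k.injective h)
      have := hk c d hcd (lt_of_le_of_ne (not_lt.1 hc) hne)
      rw [sw_left, sw_right] at this
      exact absurd hgl (not_lt.2 this.le)
    have hω := linExt_le Q.2.1 Q.2.2 (g := k) hQ hdc hkk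
    obtain ⟨Q, q1, q2, q3, q4⟩ := flipF (inferInstanceAs (DecidableEq (Fin n)ᵒᵈ))
      P.2.1 P.2.2 g hg hadj harc
      (Or.inl ⟨hdc, hω⟩)
    exact ⟨⟨Q, q1, q2⟩, q3, q4⟩
  · rintro P g x y z hg hxy hyz hzy hyx ⟨Q, k, hQ, hk⟩ _ harc
    have hyx' : @LT.lt (Fin n) _ y x := hxy
    have hzy' : @LT.lt (Fin n) _ z y := hyz
    have hω := linExt_le Q.2.1 Q.2.2 (g := k) hQ hyx' hk
    rcases K_up P.2.1 (x := Fin.val z) (y := Fin.val y) (z := Fin.val x) hzy' hyx' (Fin.is_lt x)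
      (((pos_exit P.2.2 x).trans_lt hω).trans_eq (pos_exit P.2.2 y).symm) harc with h | h
    · exact absurd (path_order (g := g) hg h) (not_le.2 hzy)
    · exact absurd (path_order (g := g) hg h) (not_le.2 hyx)

end PDNet

/-- Let `σ, σ' ∈ [e, ω]` with `σ ≤ σ'` in the weak order, and let
`C = L(P)` and `C' = L(P')` be the `≡_ω`-congruence classes of `σ` and `σ'`
respectively (so `P`, `P'` are the acyclic pipe dreams of `Π(ω)` whose linear
extensions contain `σ` resp. `σ'`; each class is a weak order interval, so it has a
minimum and a maximum).  Then `min C ≤ min C'` and `max C ≤ max C'` in the weak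
order. -/
theorem class_min_max_monotone (n : ℕ) (ω : Equiv.Perm (Fin n))
    (σ σ' : Equiv.Perm (Fin n)) (hσ : WeakLE σ ω) (hσ' : WeakLE σ' ω)
    (hle : WeakLE σ σ')
    (P P' : PipeDream n)
    (hred : P.Reduced) (hexit : P.HasExitPerm ω) (hacyclic : P.Acyclic)
    (hred' : P'.Reduced) (hexit' : P'.HasExitPerm ω) (hacyclic' : P'.Acyclic)
    (hσP : P.LinExt σ) (hσ'P' : P'.LinExt σ')
    (mC MC mC' MC' : Equiv.Perm (Fin n))
    (hmC : P.LinExt mC ∧ ∀ π, P.LinExt π → WeakLE mC π)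
    (hMC : P.LinExt MC ∧ ∀ π, P.LinExt π → WeakLE π MC)
    (hmC' : P'.LinExt mC' ∧ ∀ π, P'.LinExt π → WeakLE mC' π)
    (hMC' : P'.LinExt MC' ∧ ∀ π, P'.LinExt π → WeakLE π MC') :
    WeakLE mC mC' ∧ WeakLE MC MC' := by
  have _ := hσ
  have _ := hσ'
  have rP := PDNet.red_of_reduced P hred
  have rP' := PDNet.red_of_reduced P' hred'
  constructor
  · obtain ⟨p, hp1, hp2⟩ := PDNet.down_primal ω ⟨P', rP', hexit'⟩ ⟨P, rP, hexit⟩ σ'⁻¹ mC'⁻¹ σ⁻¹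
      hσ'P' hmC'.1 (hmC'.2 σ' hσ'P') hσP hle
    have hπ : P.LinExt p⁻¹ := by
      intro i j h
      rw [inv_inv]; exact hp1 i j h
    intro i j hij h
    have h1 := hmC.2 _ hπ i j hij h
    rw [inv_inv] at h1
    exact hp2 i j hij h1
  · have conv : ∀ {x y : Equiv.Perm (Fin n)}, WeakLE x y →
        ∀ i j : Fin n, j < i → y⁻¹ j < y⁻¹ i → x⁻¹ j < x⁻¹ i := by
      intro x y hxy i j hij h
      by_contra hc
      have hne : x⁻¹ i ≠ x⁻¹ j := fun e => hij.ne' (x⁻¹.injective e)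
      have := hxy j i hij (lt_of_le_of_ne (not_lt.1 hc) hne)
      exact absurd h (not_lt.2 this.le)
    obtain ⟨p, hp1, hp2⟩ := PDNet.down_dual ω ⟨P, rP, hexit⟩ ⟨P', rP', hexit'⟩ σ⁻¹ MC⁻¹ σ'⁻¹
      hσP hMC.1 (conv (hMC.2 σ hσP)) hσ'P' (conv hle)
    have hπ : P'.LinExt p⁻¹ := by
      intro i j h
      rw [inv_inv]; exact hp1 i j h
    intro i j hij h
    apply hMC'.2 _ hπ i j hij
    rw [inv_inv]
    by_contra hc
    have hne : p i ≠ p j := fun e => hij.ne (p.injective e)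
    have := hp2 j i hij (lt_of_le_of_ne (not_lt.1 hc) hne)
    exact absurd h (not_lt.2 this.le)
end
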